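/- Let a ≥ 1 and ℓ ≥ 1 be integers, and let k ≥ 2 be a power of 2 with k(a+1) ≤ 2^ℓ − 1. Then every continuous map f : ℝP^{2^ℓ−2−a} → ℝ^{2^ℓ−2} admits a local k-multiplicity: there exists a point x₀ ∈ ℝP^{2^ℓ−2−a} such that every neighborhood of x₀ contains k pairwise distinct points x_1, …, x_k with f(x_1) = ⋯ = f(x_k). -/

import Mathlib

/-- The projectivization of a topological vector space carries the quotient topology
coming from the nonzero vectors. -/
instance projectivizationTopology (K V : Type*) [DivisionRing K] [AddCommGroup V]
    [Module K V] [TopologicalSpace V] : TopologicalSpace (Projectivization K V) :=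
  inferInstanceAs (TopologicalSpace (Quotient (projectivizationSetoid K V)))

/-- A continuous map `f : X → Y` admits a local `k`-multiplicity if there is a point
`x₀` such that every neighborhood of `x₀` contains `k` pairwise distinct points with
equal images under `f`. -/
def AdmitsLocalMultiplicity {X Y : Type*} [TopologicalSpace X] [TopologicalSpace Y]
    (f : X → Y) (k : ℕ) : Prop :=
  ∃ x₀ : X, ∀ U ∈ nhds x₀, ∃ x : Fin k → X,
    Function.Injective x ∧ (∀ i, x i ∈ U) ∧ ∀ i j, f (x i) = f (x j)

namespace ProjMult

/-! ### Mod 2 cochains on lists -/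

section Cochains

variable {α β : Type*}

/-- The coboundary of a mod `2` cochain on lists of vertices. -/
def d : (List α → ZMod 2) → List α → ZMod 2
  | _, [] => 0
  | w, a :: l => w l + d (fun t => w (a :: t)) l

/-- The cup product of the coboundary of `x` with `w`. -/
def cup (x : α → ZMod 2) (w : List α → ZMod 2) : List α → ZMod 2
  | [] => 0
  | [_] => 0
  | a :: b :: l => (x a + x b) * w (b :: l)

/-- The cup product of the `0`-cochain `u` with `w`. -/
def cut (u : α → ZMod 2) (w : List α → ZMod 2) : List α → ZMod 2
  | [] => 0
  | a :: l => u a * w (a :: l)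

/-- The unit cochain. -/
def one : List α → ZMod 2
  | [_] => 1
  | _ => 0

/-- Iterated cup product with coboundaries. -/
def cups (xs : List (α → ZMod 2)) (v : List α → ZMod 2) : List α → ZMod 2 :=
  xs.foldr cup v

/-- The homotopy between `cup x (cup y w)` and `cup y (cup x w)`. -/
def swapHom (x y : α → ZMod 2) (w : List α → ZMod 2) : List α → ZMod 2
  | [] => 0
  | [_] => 0
  | a :: b :: l => (x a + x b) * (y a + y b) * w (b :: l)

@[simp] lemma d_nil (w : List α → ZMod 2) : d w [] = 0 := rfl
lemma d_cons (w : List α → ZMod 2) (a : α) (l : List α) :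
    d w (a :: l) = w l + d (fun t => w (a :: t)) l := rfl
@[simp] lemma cup_nil (x : α → ZMod 2) (w : List α → ZMod 2) : cup x w [] = 0 := rfl
@[simp] lemma cup_single (x : α → ZMod 2) (w : List α → ZMod 2) (a : α) : cup x w [a] = 0 := rfl
@[simp] lemma cup_cons (x : α → ZMod 2) (w : List α → ZMod 2) (a b : α) (l : List α) :
    cup x w (a :: b :: l) = (x a + x b) * w (b :: l) := rfl
@[simp] lemma cut_nil (x : α → ZMod 2) (w : List α → ZMod 2) : cut x w [] = 0 := rfl
@[simp] lemma cut_cons (x : α → ZMod 2) (w : List α → ZMod 2) (a : α) (l : List α) :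
    cut x w (a :: l) = x a * w (a :: l) := rfl
@[simp] lemma one_nil : one ([] : List α) = 0 := rfl
@[simp] lemma one_single (a : α) : one [a] = 1 := rfl
@[simp] lemma one_cons (a b : α) (l : List α) : one (a :: b :: l) = 0 := rfl
@[simp] lemma cups_nil (v : List α → ZMod 2) : cups [] v = v := rfl
@[simp] lemma cups_cons (x : α → ZMod 2) (xs) (v : List α → ZMod 2) :
    cups (x :: xs) v = cup x (cups xs v) := rfl
lemma cups_append (xs ys : List (α → ZMod 2)) (v : List α → ZMod 2) :
    cups (xs ++ ys) v = cups xs (cups ys v) := by simp [cups]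
lemma cups_apply_nil (xs : List (α → ZMod 2)) {v : List α → ZMod 2} (hv : v [] = 0) :
    cups xs v [] = 0 := by cases xs <;> simp [hv]

lemma d_zero (l : List α) : d (fun _ => 0) l = 0 := by
  induction l with
  | nil => rfl
  | cons a l ih => simp [d_cons, ih]

lemma d_add (v w : List α → ZMod 2) (l : List α) :
    d (fun t => v t + w t) l = d v l + d w l := by
  induction l generalizing v w with
  | nil => simp
  | cons a l ih => simp only [d_cons, ih]; ring

lemma d_mul (r : ZMod 2) (w : List α → ZMod 2) (l : List α) :
    d (fun t => r * w t) l = r * d w l := by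
  induction l generalizing w with
  | nil => simp
  | cons a l ih => simp only [d_cons, ih]; ring

lemma d_comp_map (g : α → β) (w : List β → ZMod 2) (l : List α) :
    d (fun t => w (t.map g)) l = d w (l.map g) := by
  induction l generalizing w with
  | nil => rfl
  | cons a l ih => simpa [d_cons] using ih (fun t => w (g a :: t))

lemma two_zero (x : ZMod 2) : x + x = 0 := CharTwo.add_self_eq_zero x

lemma d_cup (x : α → ZMod 2) {w : List α → ZMod 2} (hw : w [] = 0) (l : List α) :
    d (cup x w) l = cup x (d w) l := by
  match l with
  | [] => rfl
  | [a] => simp [d_cons]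
  | a :: b :: t =>
    simp only [d_cons, cup_cons, d_mul]
    cases t with
    | nil => simp [hw]
    | cons c t =>
      simp only [cup_cons]
      linear_combination two_zero (x c * w (c :: t))

lemma d_cut (u : α → ZMod 2) {w : List α → ZMod 2} (hw : w [] = 0) (l : List α) :
    d (cut u w) l = cup u w l + cut u (d w) l := by
  match l with
  | [] => rfl
  | [a] => simp [d_cons, hw]
  | a :: b :: t =>
    simp only [d_cons, cup_cons, d_mul, cut_cons]
    linear_combination -two_zero (u a * w (b :: t))

lemma d_swapHom (x y : α → ZMod 2) {w : List α → ZMod 2} (hw : w [] = 0) (l : List α) :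
    d (swapHom x y w) l =
      swapHom x y (d w) l + cup x (cup y w) l + cup y (cup x w) l := by
  match l with
  | [] => rfl
  | [a] => simp [d_cons, swapHom]
  | [a, b] => simp [d_cons, swapHom, hw]
  | a :: b :: c :: t =>
    simp only [d_cons, cup_cons, d_mul, swapHom]
    generalize w (c :: t) = p
    generalize d _ t = q
    generalize w (b :: t) = r
    generalize x a = xa
    generalize x b = xb
    generalize x c = xc
    generalize y a = ya
    generalize y b = yb
    generalize y c = yc
    linear_combination two_zero (-p * xb * ya - p * xa * yb - xb * yb * p + xc * yc * p)

lemma d_one (l : List α) : d one l = 0 := by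
  match l with
  | [] => rfl
  | [a] => simp [d_cons]
  | [a, b] => simp [d_cons]; exact two_zero 1
  | a :: b :: c :: t => simp [d_cons, d_zero]

end Cochains

/-! ### Shuffle products of lists -/

section Shuffle

variable {α β γ δ : Type*}

/-- `1` if both lists are empty, and `0` otherwise. -/
def bothNil : List α → List β → ZMod 2
  | [], [] => 1
  | _, _ => 0

/-- The empty path, if both lists are empty. -/
def shEnd : List α → List β → List (List (α × β))
  | [], [] => [[]]
  | _, _ => []

/-- The staircase paths in the product of two lists of vertices. -/
def sh : List α → List β → List (List (α × β))
  | [], _ => []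
  | _ :: _, [] => []
  | a :: as, b :: bs =>
    (sh as (b :: bs) ++ sh (a :: as) bs ++ shEnd as bs).map (List.cons (a, b))
  termination_by l l' => l.length + l'.length

/-- The cross product, as a functional on cochains. -/
def X (w : List (α × β) → ZMod 2) (σ : List α) (τ : List β) : ZMod 2 :=
  ((sh σ τ).map w).sum

@[simp] lemma sh_nil_left (τ : List β) : sh ([] : List α) τ = [] := by simp [sh]
@[simp] lemma sh_nil_right (σ : List α) : sh σ ([] : List β) = [] := by cases σ <;> simp [sh]
@[simp] lemma X_nil_left (w : List (α × β) → ZMod 2) (τ : List β) : X w [] τ = 0 := by simp [X]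
@[simp] lemma X_nil_right (w : List (α × β) → ZMod 2) (σ : List α) : X w σ [] = 0 := by simp [X]

lemma X_cons (w : List (α × β) → ZMod 2) (a : α) (as : List α) (b : β) (bs : List β) :
    X w (a :: as) (b :: bs) = X (fun s => w ((a, b) :: s)) as (b :: bs) +
      X (fun s => w ((a, b) :: s)) (a :: as) bs + bothNil as bs * w [(a, b)] := by
  rw [X, sh]
  cases as <;> cases bs <;> simp [X, shEnd, bothNil, Function.comp_def]

lemma X_add (v w : List (α × β) → ZMod 2) (σ : List α) (τ : List β) :
    X (fun s => v s + w s) σ τ = X v σ τ + X w σ τ := by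
  simp [X, List.sum_map_add]

lemma X_mul (r : ZMod 2) (w : List (α × β) → ZMod 2) (σ : List α) (τ : List β) :
    X (fun s => r * w s) σ τ = r * X w σ τ := by
  simp [X, List.sum_map_mul_left]

lemma X_congr {v w : List (α × β) → ZMod 2} {σ : List α} {τ : List β}
    (h : ∀ s ∈ sh σ τ, v s = w s) : X v σ τ = X w σ τ := by
  rw [X, X, List.map_congr_left h]

lemma exists_of_mem_sh {a : α} {as : List α} {b : β} {bs : List β} {s : List (α × β)}
    (h : s ∈ sh (a :: as) (b :: bs)) : ∃ t, s = (a, b) :: t := by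
  rw [sh, List.mem_map] at h
  obtain ⟨t, -, rfl⟩ := h
  exact ⟨t, rfl⟩

lemma mem_sh_cons {a : α} {as : List α} {b : β} {bs : List β} {s : List (α × β)} :
    s ∈ sh (a :: as) (b :: bs) ↔
      (∃ t, s = (a, b) :: t ∧ (t ∈ sh as (b :: bs) ∨ t ∈ sh (a :: as) bs)) ∨
        (as = [] ∧ bs = [] ∧ s = [(a, b)]) := by
  rw [sh, List.mem_map]
  cases as <;> cases bs <;> simp [shEnd, eq_comm, and_comm]

lemma ne_nil_of_mem_sh {σ : List α} {τ : List β} {s : List (α × β)} (h : s ∈ sh σ τ) :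
    s ≠ [] := by
  rcases σ with _ | ⟨a, as⟩
  · simp at h
  rcases τ with _ | ⟨b, bs⟩
  · simp at h
  obtain ⟨t, rfl⟩ := exists_of_mem_sh h
  simp

lemma sh_induction {P : List α → List β → List (α × β) → Prop}
    (single : ∀ a b, P [a] [b] [(a, b)])
    (left : ∀ a as b bs t, t ∈ sh as (b :: bs) → P as (b :: bs) t →
      P (a :: as) (b :: bs) ((a, b) :: t))
    (right : ∀ a as b bs t, t ∈ sh (a :: as) bs → P (a :: as) bs t →
      P (a :: as) (b :: bs) ((a, b) :: t)) :
    ∀ (σ : List α) (τ : List β), ∀ s ∈ sh σ τ, P σ τ s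
  | [], _, s, h => by simp at h
  | _ :: _, [], s, h => by simp at h
  | a :: as, b :: bs, s, h => by
    rcases mem_sh_cons.1 h with ⟨t, rfl, ht | ht⟩ | ⟨rfl, rfl, rfl⟩
    · exact left a as b bs t ht (sh_induction single left right as (b :: bs) t ht)
    · exact right a as b bs t ht (sh_induction single left right (a :: as) bs t ht)
    · exact single a b
  termination_by σ τ => σ.length + τ.length

lemma mem_of_mem_sh {σ : List α} {τ : List β} {s : List (α × β)} (h : s ∈ sh σ τ) :
    ∀ p ∈ s, p.1 ∈ σ ∧ p.2 ∈ τ := by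
  refine sh_induction (P := fun σ τ s => ∀ p ∈ s, p.1 ∈ σ ∧ p.2 ∈ τ) ?_ ?_ ?_ σ τ s h
  · simp
  · intro a as b bs t _ ih p hp
    rcases List.mem_cons.1 hp with rfl | hp
    · simp
    · exact ⟨List.mem_cons_of_mem _ (ih p hp).1, (ih p hp).2⟩
  · intro a as b bs t _ ih p hp
    rcases List.mem_cons.1 hp with rfl | hp
    · simp
    · exact ⟨(ih p hp).1, List.mem_cons_of_mem _ (ih p hp).2⟩

lemma length_of_mem_sh {σ : List α} {τ : List β} {s : List (α × β)} (h : s ∈ sh σ τ) :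
    s.length + 1 = σ.length + τ.length := by
  refine sh_induction (P := fun σ τ s => s.length + 1 = σ.length + τ.length) ?_ ?_ ?_ σ τ s h
  · simp
  · intro a as b bs t _ ih
    simp at *; omega
  · intro a as b bs t _ ih
    simp at *; omega

lemma pairwise_of_mem_sh {σ : List α} {τ : List β} {s : List (α × β)} (h : s ∈ sh σ τ)
    (r : α → ℕ) (r' : β → ℕ) (hσ : σ.Pairwise fun a b => r a < r b)
    (hτ : τ.Pairwise fun a b => r' a < r' b) :
    s.Pairwise fun p q => r p.1 + r' p.2 < r q.1 + r' q.2 := by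
  revert hσ hτ
  refine sh_induction (P := fun σ τ s => σ.Pairwise (fun a b => r a < r b) →
    τ.Pairwise (fun a b => r' a < r' b) →
    s.Pairwise fun p q => r p.1 + r' p.2 < r q.1 + r' q.2) ?_ ?_ ?_ σ τ s h
  · simp
  · intro a as b bs t ht ih hσ hτ
    refine List.pairwise_cons.2 ⟨fun q hq => ?_, ih (List.pairwise_cons.1 hσ).2 hτ⟩
    have h1 := (List.pairwise_cons.1 hσ).1 _ (mem_of_mem_sh ht q hq).1
    have h2 := (mem_of_mem_sh ht q hq).2
    rcases List.mem_cons.1 h2 with h2 | h2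
    · simp only [h2]; omega
    · have := (List.pairwise_cons.1 hτ).1 _ h2
      simp only; omega
  · intro a as b bs t ht ih hσ hτ
    refine List.pairwise_cons.2 ⟨fun q hq => ?_, ih hσ (List.pairwise_cons.1 hτ).2⟩
    have h1 := (List.pairwise_cons.1 hτ).1 _ (mem_of_mem_sh ht q hq).2
    have h2 := (mem_of_mem_sh ht q hq).1
    rcases List.mem_cons.1 h2 with h2 | h2
    · simp only [h2]; omega
    · have := (List.pairwise_cons.1 hσ).1 _ h2
      simp only; omega

lemma X_cut (u : α × β → ZMod 2) (w : List (α × β) → ZMod 2) (a : α) (as : List α) (b : β)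
    (bs : List β) : X (cut u w) (a :: as) (b :: bs) = u (a, b) * X w (a :: as) (b :: bs) := by
  rw [← X_mul]
  refine X_congr fun s hs => ?_
  obtain ⟨t, rfl⟩ := exists_of_mem_sh hs
  rfl

lemma X_cup (x : α × β → ZMod 2) (w : List (α × β) → ZMod 2) (a : α) (as : List α) (b : β)
    (bs : List β) : X (cup x w) (a :: as) (b :: bs) =
      (x (a, b) + x (as.headD a, b)) * X w as (b :: bs) +
        (x (a, b) + x (a, bs.headD b)) * X w (a :: as) bs := by
  rw [X_cons, cup_single, mul_zero, add_zero, ← X_mul, ← X_mul]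
  congr 1
  · rcases as with _ | ⟨a', as⟩
    · simp
    · refine X_congr fun s hs => ?_
      obtain ⟨t, rfl⟩ := exists_of_mem_sh hs
      rfl
  · rcases bs with _ | ⟨b', bs⟩
    · simp
    · refine X_congr fun s hs => ?_
      obtain ⟨t, rfl⟩ := exists_of_mem_sh hs
      rfl

lemma X_swap (w : List (β × α) → ZMod 2) :
    ∀ (σ : List α) (τ : List β), X (fun s => w (s.map Prod.swap)) σ τ = X w τ σ
  | [], _ => by simp
  | _ :: _, [] => by simp
  | a :: as, b :: bs => by
    have h1 := X_swap (fun s => w ((b, a) :: s)) as (b :: bs)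
    have h2 := X_swap (fun s => w ((b, a) :: s)) (a :: as) bs
    rw [X_cons, X_cons, ← h1, ← h2]
    have : bothNil as bs = bothNil bs as := by cases as <;> cases bs <;> rfl
    simp only [List.map_cons, Prod.swap_prod_mk, List.map_nil, this]
    ring
  termination_by σ τ => σ.length + τ.length

lemma X_map (f : α → γ) (g : β → δ) (w : List (γ × δ) → ZMod 2) :
    ∀ (σ : List α) (τ : List β),
      X (fun s => w (s.map (Prod.map f g))) σ τ = X w (σ.map f) (τ.map g)
  | [], _ => by simp
  | _ :: _, [] => by simp
  | a :: as, b :: bs => by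
    have h1 := X_map f g (fun s => w ((f a, g b) :: s)) as (b :: bs)
    have h2 := X_map f g (fun s => w ((f a, g b) :: s)) (a :: as) bs
    simp only [List.map_cons] at h1 h2 ⊢
    rw [X_cons, X_cons, ← h1, ← h2]
    have : bothNil as bs = bothNil (as.map f) (bs.map g) := by cases as <;> cases bs <;> rfl
    simp [this]
  termination_by σ τ => σ.length + τ.length

lemma d_mul_ite (r : ZMod 2) (bs : List β) (l : List α) :
    d (fun t : List α => bothNil t bs * r) l =
      (match l, bs with
        | [_], [] => r
        | _, _ => 0) := by
  rcases l with _ | ⟨a, _ | ⟨b, l⟩⟩ <;> rcases bs with _ | ⟨c, bs⟩ <;> simp [d_cons, bothNil, d_zero]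

lemma X_d_aux : ∀ (w : List (α × β) → ZMod 2) (σ : List α) (τ : List β),
    X (d w) σ τ + (match σ, τ with | [_], [_] => w [] | _, _ => 0) =
      d (fun s => X w s τ) σ + d (fun t => X w σ t) τ
  | w, [], _ => by simp [d_zero]
  | w, _ :: _, [] => by simp [d_zero]
  | w, a :: as, b :: bs => by
    have h1 := X_d_aux (fun s => w ((a, b) :: s)) as (b :: bs)
    have h2 := X_d_aux (fun s => w ((a, b) :: s)) (a :: as) bs
    have e : bothNil as bs = bothNil bs as := by cases as <;> cases bs <;> rfl
    have e2 : ∀ t : List β, bothNil as t = bothNil t as := by intro t; cases as <;> cases t <;> rfl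
    rw [X_cons]
    simp only [d_cons, X_cons, d_add, X_add, e2, d_mul_ite] at h1 h2 ⊢
    rcases as with _ | ⟨a', _ | ⟨a'', as⟩⟩ <;> rcases bs with _ | ⟨b', _ | ⟨b'', bs⟩⟩ <;>
      simp [bothNil, d_cons, d_zero, X_cons] at h1 h2 ⊢ <;> grind
  termination_by _ σ τ => σ.length + τ.length

lemma X_d {w : List (α × β) → ZMod 2} (hw : w [] = 0) (σ : List α) (τ : List β) :
    X (d w) σ τ = d (fun s => X w s τ) σ + d (fun t => X w σ t) τ := by
  rw [← X_d_aux]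
  rcases σ with _ | ⟨a, _ | ⟨a', as⟩⟩ <;> rcases τ with _ | ⟨b, _ | ⟨b', bs⟩⟩ <;> simp [hw]

end Shuffle

/-! ### Functionals invariant under two commuting involutions -/

section Functional

variable {Y : Type*}

/-- A mod `2` cycle in the part `P` of `Y`, invariant under `S` and `T`. -/
structure InvCycle (P : Y → Prop) (S T : Y → Y) (A : (List Y → ZMod 2) → ZMod 2) : Prop where
  add : ∀ v w, A (fun l => v l + w l) = A v + A w
  congr : ∀ v w : List Y → ZMod 2, (∀ l, l ≠ [] → (∀ p ∈ l, P p) → v l = w l) → A v = A w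
  bdry : ∀ v : List Y → ZMod 2, v [] = 0 → A (d v) = 0
  swap : ∀ v : List Y → ZMod 2, A (fun l => v (l.map S)) = A v
  trans : ∀ v : List Y → ZMod 2, A (fun l => v (l.map T)) = A v

/-- Invariance of a cochain on lists in `P`. -/
def InvOn (P : Y → Prop) (S : Y → Y) (v : List Y → ZMod 2) : Prop :=
  ∀ l, l ≠ [] → (∀ p ∈ l, P p) → v (l.map S) = v l

/-- Invariance of a function on `P` up to a constant. -/
def SemiOn (P : Y → Prop) (S : Y → Y) (x : Y → ZMod 2) : Prop :=
  ∃ e, ∀ p, P p → x (S p) = x p + e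

variable {P : Y → Prop} {S T : Y → Y} {A : (List Y → ZMod 2) → ZMod 2}

lemma invOn_one : InvOn P S one := by
  intro l hl h
  rcases l with _ | ⟨a, _ | ⟨b, l⟩⟩ <;> simp at hl ⊢

lemma InvOn.cup {v : List Y → ZMod 2} {x : Y → ZMod 2} (hv : InvOn P S v) (hx : SemiOn P S x) :
    InvOn P S (cup x v) := by
  obtain ⟨e, hx⟩ := hx
  intro l hl h
  rcases l with _ | ⟨a, _ | ⟨b, l⟩⟩
  · simp
  · simp
  · have := hv (b :: l) (by simp) (fun p hp => h p (List.mem_cons_of_mem _ hp))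
    simp only [List.map_cons] at this
    simp only [List.map_cons, cup_cons, this, hx a (h a (by simp)), hx b (h b (by simp))]
    linear_combination two_zero (e * v (b :: l))

lemma InvOn.cups {v : List Y → ZMod 2} {xs : List (Y → ZMod 2)} (hv : InvOn P S v)
    (hx : ∀ x ∈ xs, SemiOn P S x) : InvOn P S (cups xs v) := by
  induction xs with
  | nil => exact hv
  | cons x xs ih =>
    exact (ih fun y hy => hx y (List.mem_cons_of_mem _ hy)).cup (hx x (by simp))

lemma InvOn.cut {v : List Y → ZMod 2} {x : Y → ZMod 2} (hv : InvOn P S v)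
    (hx : ∀ p, P p → x (S p) = x p) : InvOn P S (cut x v) := by
  intro l hl h
  rcases l with _ | ⟨a, l⟩
  · simp
  · have := hv (a :: l) (by simp) h
    simp only [List.map_cons] at this
    simp only [List.map_cons, cut_cons, this, hx a (h a (by simp))]

lemma InvOn.swapHom {v : List Y → ZMod 2} {x y : Y → ZMod 2} (hv : InvOn P S v)
    (hx : SemiOn P S x) (hy : SemiOn P S y) : InvOn P S (swapHom x y v) := by
  obtain ⟨e, hx⟩ := hx
  obtain ⟨e', hy⟩ := hy
  intro l hl h
  rcases l with _ | ⟨a, _ | ⟨b, l⟩⟩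
  · rfl
  · rfl
  · have := hv (b :: l) (by simp) (fun p hp => h p (List.mem_cons_of_mem _ hp))
    simp only [List.map_cons] at this
    simp only [List.map_cons, ProjMult.swapHom, this, hx a (h a (by simp)), hx b (h b (by simp)),
      hy a (h a (by simp)), hy b (h b (by simp))]
    have h1 := two_zero e
    have h2 := two_zero e'
    linear_combination (y a + y b + (e' + e')) * v (b :: l) * h1 + (x a + x b) * v (b :: l) * h2

lemma d_cups {xs : List (Y → ZMod 2)} {v : List Y → ZMod 2} (hv : v [] = 0) :
    d (cups xs v) = cups xs (d v) := by
  induction xs with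
  | nil => rfl
  | cons x xs ih =>
    funext l
    rw [cups_cons, d_cup x (cups_apply_nil _ hv), ih, cups_cons]

lemma cup_zero (x : Y → ZMod 2) : cup x (fun _ => 0) = fun _ => 0 := by
  funext l
  rcases l with _ | ⟨a, _ | ⟨b, l⟩⟩ <;> simp

lemma cups_zero (xs : List (Y → ZMod 2)) : cups xs (fun _ => 0) = fun _ => 0 := by
  induction xs with
  | nil => rfl
  | cons x xs ih => rw [cups_cons, ih, cup_zero]

lemma d_one' : d (one : List Y → ZMod 2) = fun _ => 0 := funext d_one

lemma d_cups_one (xs : List (Y → ZMod 2)) : d (cups xs one) = fun _ => 0 := by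
  rw [d_cups one_nil, d_one', cups_zero]

lemma cup_add (x : Y → ZMod 2) (v w : List Y → ZMod 2) :
    cup x (fun l => v l + w l) = fun l => cup x v l + cup x w l := by
  funext l
  rcases l with _ | ⟨a, _ | ⟨b, l⟩⟩ <;> simp [mul_add]

lemma cups_add (xs : List (Y → ZMod 2)) (v w : List Y → ZMod 2) :
    cups xs (fun l => v l + w l) = fun l => cups xs v l + cups xs w l := by
  induction xs with
  | nil => rfl
  | cons x xs ih => rw [cups_cons, ih, cup_add]; rfl

lemma cut_add (x : Y → ZMod 2) (v w : List Y → ZMod 2) :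
    cut x (fun l => v l + w l) = fun l => cut x v l + cut x w l := by
  funext l
  rcases l with _ | ⟨a, l⟩ <;> simp [mul_add]

lemma add_cup (x y : Y → ZMod 2) (v : List Y → ZMod 2) :
    cup (fun p => x p + y p) v = fun l => cup x v l + cup y v l := by
  funext l
  rcases l with _ | ⟨a, _ | ⟨b, l⟩⟩
  · simp
  · simp
  · simp only [cup_cons]; ring

lemma cup_add_const (x : Y → ZMod 2) (e : ZMod 2) (v : List Y → ZMod 2) :
    cup (fun p => x p + e) v = cup x v := by
  funext l
  rcases l with _ | ⟨a, _ | ⟨b, l⟩⟩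
  · simp
  · simp
  · simp only [cup_cons]; linear_combination v (b :: l) * two_zero e

lemma d_swapHom_cups (x y : Y → ZMod 2) (xs ys : List (Y → ZMod 2)) :
    (fun l => cups xs (cup x (cup y (cups ys one))) l + cups xs (cup y (cup x (cups ys one))) l) =
      d (cups xs (swapHom x y (cups ys one))) := by
  rw [d_cups rfl, ← cups_add]
  congr 1
  funext l
  rw [d_swapHom x y (cups_apply_nil _ one_nil), d_cups_one]
  have : swapHom x y (fun _ => 0) l = 0 := by
    rcases l with _ | ⟨a, _ | ⟨b, l⟩⟩ <;> simp [swapHom]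
  rw [this, zero_add]

namespace InvCycle

variable (hA : InvCycle P S T A)
include hA

lemma kill_aux {R : Y → Y} (hR : ∀ v : List Y → ZMod 2, A (fun l => v (l.map R)) = A v)
    {x : Y → ZMod 2} (hx : ∀ p, P p → x (R p) = x p + 1) {q : List Y → ZMod 2}
    (hq : InvOn P R q) : A q = 0 := by
  have h1 : A q = A (fun l => cut x q l + cut x q (l.map R)) := by
    refine hA.congr _ _ fun l hl h => ?_
    rcases l with _ | ⟨a, l⟩
    · exact absurd rfl hl
    · have := hq (a :: l) hl h
      simp only [List.map_cons] at this ⊢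
      rw [cut_cons, cut_cons, this, hx a (h a (by simp))]
      linear_combination -two_zero (x a * q (a :: l))
  rw [h1, hA.add, hR]
  exact two_zero _

end InvCycle

/-- The labels used in the evaluation: `M` is odd under `S` and even under `T`, while `L` is
even under `S` and odd under `T`. -/
structure Labels (P : Y → Prop) (S T : Y → Y) (M L : Y → ZMod 2) : Prop where
  M_swap : ∀ p, P p → M (S p) = M p + 1
  M_trans : ∀ p, P p → M (T p) = M p
  L_swap : ∀ p, P p → L (S p) = L p
  L_trans : ∀ p, P p → L (T p) = L p + 1

/-- The evaluation of a functional on a localized cup product. -/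
def ev (A : (List Y → ZMod 2) → ZMod 2) (M L : Y → ZMod 2) (v : List Y → ZMod 2) : ZMod 2 :=
  A (cut (fun p => M p + 1) (cut (fun p => L p + 1) v))

section Ev

variable {M L : Y → ZMod 2}

lemma Labels.kill_swap (h : Labels P S T M L) (hA : InvCycle P S T A) {q : List Y → ZMod 2}
    (hq : InvOn P S q) : A q = 0 := hA.kill_aux hA.swap h.M_swap hq

lemma Labels.kill_trans (h : Labels P S T M L) (hA : InvCycle P S T A) {q : List Y → ZMod 2}
    (hq : InvOn P T q) : A q = 0 := hA.kill_aux hA.trans h.L_trans hq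

lemma Labels.ev_d (h : Labels P S T M L) (hA : InvCycle P S T A) {v : List Y → ZMod 2}
    (hv : v [] = 0) (hS : InvOn P S v) (hT : InvOn P T v) : ev A M L (d v) = 0 := by
  have h1 : A (fun l => d (cut (fun p => M p + 1) (cut (fun p => L p + 1) v)) l) = 0 :=
    hA.bdry _ rfl
  have h2 : (fun l => d (cut (fun p => M p + 1) (cut (fun p => L p + 1) v)) l) =
      fun l => (cup (fun p => M p + 1) (cut (fun p => L p + 1) v) l +
        cut (fun p => M p + 1) (cup (fun p => L p + 1) v) l) +
        cut (fun p => M p + 1) (cut (fun p => L p + 1) (d v)) l := by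
    funext l
    have : d (cut (fun p => L p + 1) v) = fun l => cup (fun p => L p + 1) v l +
      cut (fun p => L p + 1) (d v) l := funext fun l => d_cut _ hv l
    rw [d_cut _ rfl, this, cut_add, add_assoc]
  rw [h2, hA.add, hA.add] at h1
  have h3 : A (fun l => cup (fun p => M p + 1) (cut (fun p => L p + 1) v) l) = 0 := by
    refine h.kill_swap hA ((hS.cut fun p hp => ?_).cup ⟨1, fun p hp => ?_⟩)
    · rw [h.L_swap p hp]
    · simp only [h.M_swap p hp]
  have h4 : A (fun l => cut (fun p => M p + 1) (cup (fun p => L p + 1) v) l) = 0 := by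
    refine h.kill_trans hA ((hT.cup ⟨1, fun p hp => ?_⟩).cut fun p hp => ?_)
    · rw [h.L_trans p hp]
    · rw [h.M_trans p hp]
  rw [h3, h4, zero_add, zero_add] at h1
  exact h1

lemma ev_add (hA : InvCycle P S T A) (v w : List Y → ZMod 2) :
    ev A M L (fun l => v l + w l) = ev A M L v + ev A M L w := by
  rw [ev, cut_add, cut_add, hA.add]; rfl

lemma Labels.ev_perm (h : Labels P S T M L) (hA : InvCycle P S T A)
    {xs ys : List (Y → ZMod 2)} (hxy : xs.Perm ys) (hS : ∀ x ∈ xs, SemiOn P S x)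
    (hT : ∀ x ∈ xs, SemiOn P T x) : ev A M L (cups xs one) = ev A M L (cups ys one) := by
  suffices ∀ pre : List (Y → ZMod 2), (∀ x ∈ pre, SemiOn P S x) → (∀ x ∈ pre, SemiOn P T x) →
      ev A M L (cups (pre ++ xs) one) = ev A M L (cups (pre ++ ys) one) by
    simpa using this [] (by simp) (by simp)
  induction hxy with
  | nil => intros; rfl
  | @cons x xs ys hxy ih =>
    intro pre h1 h2
    have := ih (fun y hy => hS y (by simp [hy])) (fun y hy => hT y (by simp [hy])) (pre ++ [x])
      (fun y hy => (List.mem_append.1 hy).elim (h1 y) fun hy => by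
        rw [List.mem_singleton.1 hy]; exact hS x (by simp))
      (fun y hy => (List.mem_append.1 hy).elim (h2 y) fun hy => by
        rw [List.mem_singleton.1 hy]; exact hT x (by simp))
    simpa using this
  | swap x y xs =>
    intro pre h1 h2
    rw [cups_append, cups_append]
    refine eq_of_sub_eq_zero ?_
    rw [CharTwo.sub_eq_add, ← ev_add hA]
    simp only [cups_cons]
    rw [d_swapHom_cups]
    refine h.ev_d hA (cups_apply_nil _ rfl) (InvOn.cups ?_ h1) (InvOn.cups ?_ h2)
    · exact (invOn_one.cups fun z hz => hS z (by simp [hz])).swapHom (hS y (by simp))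
        (hS x (by simp))
    · exact (invOn_one.cups fun z hz => hT z (by simp [hz])).swapHom (hT y (by simp))
        (hT x (by simp))
  | trans h1 h2 ih1 ih2 =>
    intro pre h3 h4
    rw [ih1 hS hT pre h3 h4]
    exact ih2 (fun x hx => hS x (h1.mem_iff.2 hx)) (fun x hx => hT x (h1.mem_iff.2 hx)) pre h3 h4

lemma Labels.ev_replace (h : Labels P S T M L) (hA : InvCycle P S T A) {x y : Y → ZMod 2}
    (hS : ∀ p, P p → x (S p) + y (S p) = x p + y p)
    (hT : ∀ p, P p → x (T p) + y (T p) = x p + y p) {zs : List (Y → ZMod 2)}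
    (hzS : ∀ z ∈ zs, SemiOn P S z) (hzT : ∀ z ∈ zs, SemiOn P T z) :
    ev A M L (cups (x :: zs) one) = ev A M L (cups (y :: zs) one) := by
  refine eq_of_sub_eq_zero ?_
  rw [CharTwo.sub_eq_add, ← ev_add hA]
  simp only [cups_cons]
  rw [← add_cup]
  have : cup (fun p => x p + y p) (cups zs one) = d (cut (fun p => x p + y p) (cups zs one)) := by
    funext l
    rw [d_cut _ (cups_apply_nil _ one_nil), d_cups_one]
    rcases l with _ | ⟨a, l⟩ <;> simp
  rw [this]
  exact h.ev_d hA rfl ((invOn_one.cups hzS).cut hS) ((invOn_one.cups hzT).cut hT)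

lemma Labels.semi_M (h : Labels P S T M L) : SemiOn P S M ∧ SemiOn P T M :=
  ⟨⟨1, h.M_swap⟩, ⟨0, fun p hp => by rw [h.M_trans p hp, add_zero]⟩⟩

lemma Labels.semi_L (h : Labels P S T M L) : SemiOn P S L ∧ SemiOn P T L :=
  ⟨⟨0, fun p hp => by rw [h.L_swap p hp, add_zero]⟩, ⟨1, h.L_trans⟩⟩

lemma Labels.semi_add (h : Labels P S T M L) :
    SemiOn P S (fun p => L p + M p) ∧ SemiOn P T (fun p => L p + M p) :=
  ⟨⟨1, fun p hp => by simp only [h.L_swap p hp, h.M_swap p hp]; ring⟩,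
    ⟨1, fun p hp => by simp only [h.L_trans p hp, h.M_trans p hp]; ring⟩⟩

lemma Labels.ev_replicate (h : Labels P S T M L) (hA : InvCycle P S T A)
    (rs zs : List (Y → ZMod 2))
    (hrS : ∀ r ∈ rs, ∀ p, P p → r (S p) = r p + 1) (hrT : ∀ r ∈ rs, ∀ p, P p → r (T p) = r p)
    (hzS : ∀ z ∈ zs, SemiOn P S z) (hzT : ∀ z ∈ zs, SemiOn P T z) :
    ev A M L (cups (rs ++ zs) one) =
      ev A M L (cups (List.replicate rs.length M ++ zs) one) := by
  induction rs generalizing zs with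
  | nil => rfl
  | cons r rs ih =>
    have hS : ∀ z ∈ rs ++ zs, SemiOn P S z := fun z hz =>
      (List.mem_append.1 hz).elim (fun hz => ⟨1, hrS z (by simp [hz])⟩) (hzS z)
    have hT : ∀ z ∈ rs ++ zs, SemiOn P T z := fun z hz =>
      (List.mem_append.1 hz).elim
        (fun hz => ⟨0, fun p hp => by rw [hrT z (by simp [hz]) p hp, add_zero]⟩) (hzT z)
    have h1 : ev A M L (cups (r :: (rs ++ zs)) one) = ev A M L (cups (M :: (rs ++ zs)) one) := by
      refine h.ev_replace hA (fun p hp => ?_) (fun p hp => ?_) hS hT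
      · rw [hrS r (by simp) p hp, h.M_swap p hp]
        linear_combination two_zero 1
      · rw [hrT r (by simp) p hp, h.M_trans p hp]
    have h2 : ev A M L (cups (M :: (rs ++ zs)) one) = ev A M L (cups (rs ++ M :: zs) one) := by
      refine h.ev_perm hA List.perm_middle.symm ?_ ?_
      · intro x hx
        rcases List.mem_cons.1 hx with rfl | hx
        exacts [h.semi_M.1, hS x hx]
      · intro x hx
        rcases List.mem_cons.1 hx with rfl | hx
        exacts [h.semi_M.2, hT x hx]
    rw [List.cons_append, h1, h2, ih (M :: zs) (fun r hr => hrS r (by simp [hr]))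
      (fun r hr => hrT r (by simp [hr]))
      (fun z hz => by
        rcases List.mem_cons.1 hz with rfl | hz
        exacts [h.semi_M.1, hzS z hz])
      (fun z hz => by
        rcases List.mem_cons.1 hz with rfl | hz
        exacts [h.semi_M.2, hzT z hz])]
    refine congrArg (fun xs => ev A M L (cups xs one)) ?_
    rw [List.length_cons, List.replicate_succ', List.append_assoc]
    rfl

lemma Labels.ev_pascal (h : Labels P S T M L) (hA : InvCycle P S T A) {D : ℕ}
    (hbase : ∀ p q, p + q + 1 = 2 * D →
      ev A M L (cups (List.replicate p L ++ List.replicate q (fun y => L y + M y)) one) =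
        if p = D ∨ q = D then 1 else 0) (i p q : ℕ) (hi : i + p + q + 1 = 2 * D) :
    ev A M L (cups (List.replicate i M ++ (List.replicate p L ++
      List.replicate q (fun y => L y + M y))) one) =
        if p ≤ D then (((i + 1).choose (D - p) : ℕ) : ZMod 2) else 0 := by
  induction i generalizing p q with
  | zero =>
    rw [List.replicate_zero, List.nil_append, hbase p q (by omega)]
    rcases lt_trichotomy p D with hp | rfl | hp
    · rcases eq_or_ne q D with rfl | hq
      · have : q - p = 1 := by omega
        simp [hp.le, this]
      · have : Nat.choose (0 + 1) (D - p) = 0 := Nat.choose_eq_zero_of_lt (by omega)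
        rw [if_neg (by omega), this]
        simp
    · simp
    · rw [if_neg (by omega), if_neg (by omega)]
  | succ i ih =>
    have hsemi : ∀ x ∈ List.replicate i M ++ (List.replicate p L ++
        List.replicate q (fun y => L y + M y)), SemiOn P S x ∧ SemiOn P T x := by
      intro x hx
      simp only [List.mem_append, List.mem_replicate] at hx
      rcases hx with ⟨-, rfl⟩ | ⟨-, rfl⟩ | ⟨-, rfl⟩
      exacts [h.semi_M, h.semi_L, h.semi_add]
    set ws := List.replicate i M ++ (List.replicate p L ++
        List.replicate q (fun y => L y + M y)) with hws
    have h0 : ev A M L (cups (M :: ws) one) = ev A M L (cups (L :: ws) one) +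
        ev A M L (cups ((fun y => L y + M y) :: ws) one) := by
      rw [← ev_add hA]
      simp only [cups_cons]
      rw [← add_cup]
      congr 2
      funext y
      linear_combination -two_zero (L y)
    have h1 : ev A M L (cups (L :: ws) one) = ev A M L (cups (List.replicate i M ++
        (List.replicate (p + 1) L ++ List.replicate q (fun y => L y + M y))) one) := by
      refine h.ev_perm hA ?_ ?_ ?_
      · rw [hws, List.replicate_succ, List.cons_append]
        exact List.perm_middle.symm
      · intro x hx
        rcases List.mem_cons.1 hx with rfl | hx
        exacts [h.semi_L.1, (hsemi x hx).1]
      · intro x hx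
        rcases List.mem_cons.1 hx with rfl | hx
        exacts [h.semi_L.2, (hsemi x hx).2]
    have h2 : ev A M L (cups ((fun y => L y + M y) :: ws) one) =
        ev A M L (cups (List.replicate i M ++
        (List.replicate p L ++ List.replicate (q + 1) (fun y => L y + M y))) one) := by
      refine h.ev_perm hA ?_ ?_ ?_
      · rw [hws, List.replicate_succ, ← List.append_assoc, ← List.append_assoc]
        exact List.perm_middle.symm
      · intro x hx
        rcases List.mem_cons.1 hx with rfl | hx
        exacts [h.semi_add.1, (hsemi x hx).1]
      · intro x hx
        rcases List.mem_cons.1 hx with rfl | hx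
        exacts [h.semi_add.2, (hsemi x hx).2]
    rw [List.replicate_succ, List.cons_append, h0, h1, h2, ih _ _ (by omega), ih _ _ (by omega)]
    rcases lt_trichotomy p D with hp | rfl | hp
    · obtain ⟨e, rfl⟩ : ∃ e, D = p + 1 + e := ⟨D - (p + 1), by omega⟩
      have e1 : p + 1 + e - p = e + 1 := by omega
      have e2 : p + 1 + e - (p + 1) = e := by omega
      rw [if_pos (by omega), if_pos (by omega), if_pos (by omega), e1, e2,
        Nat.choose_succ_succ (i + 1)]
      push_cast; ring
    · simp
    · rw [if_neg (by omega), if_neg (by omega), if_neg (by omega), add_zero]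

end Ev

end Functional

/-! ### The square of a cycle -/

section Pairing

variable {α β : Type*}

/-- The value of a cochain on a chain. -/
def pr (c : List (List α)) (w : List α → ZMod 2) : ZMod 2 := (c.map w).sum

/-- The value of a cochain on the square of a chain. -/
def Phi (c : List (List α)) (w : List (α × α) → ZMod 2) : ZMod 2 :=
  pr c fun σ => pr c fun τ => X w σ τ

lemma pr_add (c : List (List α)) (v w : List α → ZMod 2) :
    pr c (fun l => v l + w l) = pr c v + pr c w := List.sum_map_add

lemma pr_congr {c : List (List α)} {v w : List α → ZMod 2} (h : ∀ l ∈ c, v l = w l) :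
    pr c v = pr c w := by rw [pr, pr, List.map_congr_left h]

lemma pr_zero (c : List (List α)) : pr c (fun _ => 0) = 0 := by simp [pr]

lemma pr_comm (c : List (List α)) (c' : List (List β)) (V : List α → List β → ZMod 2) :
    pr c (fun σ => pr c' (V σ)) = pr c' fun τ => pr c fun σ => V σ τ := by
  induction c with
  | nil => simp [pr]
  | cons σ c ih =>
    simp only [pr, List.map_cons, List.sum_cons] at ih ⊢
    rw [ih, List.sum_map_add]

lemma pr_diag (c : List (List α)) (V : List α → List α → ZMod 2)
    (h : ∀ σ ∈ c, ∀ τ ∈ c, V σ τ = V τ σ) :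
    pr c (fun σ => pr c (V σ)) = pr c fun σ => V σ σ := by
  induction c with
  | nil => simp [pr]
  | cons σ c ih =>
    have ih := ih fun σ hσ τ hτ => h σ (by simp [hσ]) τ (by simp [hτ])
    simp only [pr, List.map_cons, List.sum_cons] at ih ⊢
    rw [List.sum_map_add, ih, List.map_congr_left (g := V σ) fun τ hτ =>
      h τ (by simp [hτ]) σ (by simp)]
    linear_combination two_zero ((c.map (V σ)).sum)

lemma Phi_add (c : List (List α)) (v w : List (α × α) → ZMod 2) :
    Phi c (fun l => v l + w l) = Phi c v + Phi c w := by
  simp only [Phi, X_add, pr_add]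

lemma Phi_congr {c : List (List α)} {v w : List (α × α) → ZMod 2}
    (h : ∀ σ ∈ c, ∀ τ ∈ c, ∀ s ∈ sh σ τ, v s = w s) : Phi c v = Phi c w :=
  pr_congr fun σ hσ => pr_congr fun τ hτ => X_congr fun s hs => h σ hσ τ hτ s hs

lemma cup_map (f : α → β) (x : β → ZMod 2) (v : List β → ZMod 2) (l : List α) :
    cup x v (l.map f) = cup (fun a => x (f a)) (fun t => v (t.map f)) l := by
  rcases l with _ | ⟨a, _ | ⟨b, l⟩⟩ <;> simp

lemma cut_map (f : α → β) (x : β → ZMod 2) (v : List β → ZMod 2) (l : List α) :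
    cut x v (l.map f) = cut (fun a => x (f a)) (fun t => v (t.map f)) l := by
  rcases l with _ | ⟨a, l⟩ <;> simp

lemma one_map (f : α → β) (l : List α) : one (l.map f) = one l := by
  rcases l with _ | ⟨a, _ | ⟨b, l⟩⟩ <;> simp

lemma cups_map (f : α → β) (xs : List (β → ZMod 2)) (v : List β → ZMod 2) (l : List α) :
    cups xs v (l.map f) = cups (xs.map fun x a => x (f a)) (fun t => v (t.map f)) l := by
  induction xs generalizing l with
  | nil => rfl
  | cons x xs ih =>
    rw [cups_cons, cup_map, List.map_cons, cups_cons]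
    congr 1
    funext t
    exact ih t

end Pairing

section Square

variable {Z ι : Type*} [LinearOrder ι]

/-- A free symmetric cycle together with the localization function `nu` on its square. -/
structure Doubling (T : Z → Z) (lam : Z → ZMod 2) (mu : Z → ι) (nu : Z × Z → ZMod 2)
    (c : List (List Z)) (D : ℕ) : Prop where
  T_T : ∀ z, T (T z) = z
  lam_T : ∀ z, lam (T z) = lam z + 1
  mu_T : ∀ z, mu (T z) = mu z
  mu_inj : ∀ y z, mu y = mu z → z = y ∨ z = T y
  sorted : ∀ σ ∈ c, σ.Pairwise fun y z => mu y < mu z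
  nu_swap : ∀ y z, nu (z, y) = nu (y, z)
  nu_T : ∀ y z, nu (T y, T z) = nu (y, z)
  near : ∀ σ ∈ c, ∀ τ ∈ c, ∀ a ∈ σ, ∀ b ∈ τ, nu (a, b) = 0 → ∀ a' ∈ σ, ∀ b' ∈ τ, b' ≠ T a'
  far : ∀ σ ∈ c, ∀ τ ∈ c, ∀ a ∈ σ, ∀ b ∈ τ, nu (a, b) = 1 → ∀ a' ∈ σ, ∀ b' ∈ τ, b' ≠ a'
  far_T : ∀ σ ∈ c, ∀ τ ∈ c, ∀ a ∈ σ, ∀ b ∈ τ, nu (a, T b) = 1 →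
    ∀ a' ∈ σ, ∀ b' ∈ τ, b' ≠ T a'
  nu_diag : ∀ z, nu (z, z) = 0
  nu_anti : ∀ σ ∈ c, ∀ z ∈ σ, nu (z, T z) = 1
  inv : ∀ w : List Z → ZMod 2, pr c (fun l => w (l.map T)) = pr c w
  cyc : ∀ w : List Z → ZMod 2, w [] = 0 → pr c (d w) = 0
  odd : pr c (cut (fun z => lam z + 1) (cups (List.replicate D lam) one)) = 1

/-- The order indicator on pairs. -/
def ordM (mu : Z → ι) (p : Z × Z) : ZMod 2 := if mu p.1 ≤ mu p.2 then 0 else 1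

/-- The sign of the smaller point of a pair. -/
def signL (mu : Z → ι) (lam : Z → ZMod 2) (p : Z × Z) : ZMod 2 :=
  if mu p.1 ≤ mu p.2 then lam p.1 else lam p.2

/-- The pairs outside the diagonal and the antidiagonal. -/
def OffDiag (T : Z → Z) (p : Z × Z) : Prop := p.2 ≠ p.1 ∧ p.2 ≠ T p.1

/-- The functional obtained by localizing the square at the jumps of `nu`. -/
def jump (nu : Z × Z → ZMod 2) (c : List (List Z)) (v : List (Z × Z) → ZMod 2) : ZMod 2 :=
  Phi c (cup nu v)

namespace Doubling

variable {T : Z → Z} {lam : Z → ZMod 2} {mu : Z → ι} {nu : Z × Z → ZMod 2}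
  {c : List (List Z)} {D : ℕ} (H : Doubling T lam mu nu c D)
include H

lemma Phi_d {w : List (Z × Z) → ZMod 2} (hw : w [] = 0) : Phi c (d w) = 0 := by
  have h : Phi c (d w) = pr c (fun σ => pr c fun τ => d (fun s => X w s τ) σ) +
      pr c (fun σ => pr c fun τ => d (fun t => X w σ t) τ) := by
    rw [← pr_add]
    refine pr_congr fun σ _ => ?_
    rw [← pr_add]
    exact pr_congr fun τ _ => X_d hw σ τ
  rw [h, pr_comm]
  have h1 : ∀ τ, pr c (d fun s => X w s τ) = 0 := fun τ => H.cyc _ (X_nil_left _ _)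
  have h2 : ∀ σ, pr c (d fun t => X w σ t) = 0 := fun σ => H.cyc _ (X_nil_right _ _)
  have h3 : (fun τ => pr c fun σ => d (fun s => X w s τ) σ) = fun _ => 0 := funext h1
  have h4 : (fun σ => pr c fun τ => d (fun t => X w σ t) τ) = fun _ => 0 := funext h2
  rw [h3, h4, pr_zero, add_zero]

omit H [LinearOrder ι] in
lemma Phi_swap (w : List (Z × Z) → ZMod 2) :
    Phi c (fun l => w (l.map Prod.swap)) = Phi c w := by
  simp only [Phi, X_swap]
  exact pr_comm c c fun σ τ => X w τ σ

lemma Phi_map_right (w : List (Z × Z) → ZMod 2) :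
    Phi c (fun l => w (l.map (Prod.map id T))) = Phi c w := by
  simp only [Phi, X_map, List.map_id]
  refine pr_congr fun σ _ => ?_
  exact H.inv (X w σ)

lemma Phi_map_both (w : List (Z × Z) → ZMod 2) :
    Phi c (fun l => w (l.map (Prod.map T T))) = Phi c w := by
  simp only [Phi, X_map]
  rw [H.inv fun σ => pr c fun τ => X w σ (τ.map T)]
  exact pr_congr fun σ _ => H.inv (X w σ)

lemma ordM_T (p : Z × Z) : ordM mu (Prod.map T T p) = ordM mu p := by
  simp [ordM, H.mu_T]

lemma signL_T (p : Z × Z) : signL mu lam (Prod.map T T p) = signL mu lam p + 1 := by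
  simp only [signL, Prod.map_fst, Prod.map_snd, H.mu_T, H.lam_T]
  split_ifs <;> rfl

lemma ordM_right (p : Z × Z) : ordM mu (Prod.map id T p) = ordM mu p := by
  simp [ordM, H.mu_T]

lemma signL_right (p : Z × Z) :
    signL mu lam (Prod.map id T p) = signL mu lam p + ordM mu p := by
  simp only [signL, ordM, Prod.map_fst, Prod.map_snd, H.mu_T, H.lam_T, id]
  split_ifs <;> simp

lemma mu_ne {p : Z × Z} (hp : OffDiag T p) : mu p.1 ≠ mu p.2 := fun h =>
  (H.mu_inj _ _ h).elim hp.1 hp.2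

lemma labels : Labels (OffDiag T) Prod.swap (Prod.map T T) (ordM mu) (signL mu lam) where
  M_swap p hp := by
    rcases lt_or_gt_of_ne (H.mu_ne hp) with h | h
    · simp [ordM, h.le, h.not_ge]
    · simp only [ordM, Prod.fst_swap, Prod.snd_swap, h.le, h.not_ge, if_true, if_false]
      exact (two_zero 1).symm
  M_trans p _ := H.ordM_T p
  L_swap p hp := by
    rcases lt_or_gt_of_ne (H.mu_ne hp) with h | h <;> simp [signL, h.le, h.not_ge]
  L_trans p _ := H.signL_T p

lemma invCycle : InvCycle (OffDiag T) Prod.swap (Prod.map T T) (jump nu c) where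
  add v w := by rw [jump, cup_add, Phi_add]; rfl
  congr v w h := by
    refine Phi_congr fun σ hσ τ hτ s hs => ?_
    rcases s with _ | ⟨p, _ | ⟨q, t⟩⟩
    · rfl
    · rfl
    rw [cup_cons, cup_cons]
    rcases eq_or_ne (nu p) (nu q) with e | e
    · rw [e, two_zero, zero_mul, zero_mul]
    · have hm := mem_of_mem_sh hs
      have hp := hm p (by simp)
      have hq := hm q (by simp)
      have key : (nu (p.1, p.2) = 0 ∨ nu (q.1, q.2) = 0) ∧
          (nu (p.1, p.2) = 1 ∨ nu (q.1, q.2) = 1) := by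
        simp only [Prod.mk.eta]
        generalize nu p = x at e ⊢
        generalize nu q = y at e ⊢
        revert e; revert x y; decide
      rw [h (q :: t) (by simp) fun r hr => ?_]
      have hr := hm r (by simp only [List.mem_cons] at hr ⊢; exact Or.inr hr)
      refine ⟨?_, ?_⟩
      · rcases key.2 with h | h
        · exact H.far σ hσ τ hτ _ hp.1 _ hp.2 h _ hr.1 _ hr.2
        · exact H.far σ hσ τ hτ _ hq.1 _ hq.2 h _ hr.1 _ hr.2
      · rcases key.1 with h | h
        · exact H.near σ hσ τ hτ _ hp.1 _ hp.2 h _ hr.1 _ hr.2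
        · exact H.near σ hσ τ hτ _ hq.1 _ hq.2 h _ hr.1 _ hr.2
  bdry v hv := by
    rw [jump, ← funext (d_cup nu hv), H.Phi_d rfl]
  swap v := by
    rw [jump, jump, ← Phi_swap (cup nu v)]
    congr 1
    funext l
    rw [cup_map]
    congr 1
    funext p
    exact (H.nu_swap p.1 p.2).symm
  trans v := by
    rw [jump, jump, ← H.Phi_map_both (cup nu v)]
    congr 1
    funext l
    rw [cup_map]
    congr 1
    funext p
    exact (H.nu_T p.1 p.2).symm

/-- Cochains on the square which are invariant under the diagonal action evaluate to zero. -/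
lemma Phi_kill {q : List (Z × Z) → ZMod 2} (h0 : q [] = 0)
    (hq : ∀ l, q (l.map (Prod.map T T)) = q l) : Phi c q = 0 := by
  have h1 : q = fun l => cut (signL mu lam) q l + cut (signL mu lam) q (l.map (Prod.map T T)) := by
    funext l
    rcases l with _ | ⟨a, l⟩
    · simp [h0]
    · have := hq (a :: l)
      simp only [List.map_cons] at this ⊢
      rw [cut_cons, cut_cons, this, H.signL_T]
      linear_combination -two_zero (signL mu lam a * q (a :: l))
  rw [h1, Phi_add, H.Phi_map_both]
  exact two_zero _

end Doubling

end Square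

/-! ### Evaluation on the diagonal -/

section Diagonal

variable {Z ι : Type*} [LinearOrder ι] {T : Z → Z} {lam : Z → ZMod 2} {mu : Z → ι}

/-- No pair of points of the two lists is antipodal. -/
def NoAnti (T : Z → Z) (σ τ : List Z) : Prop := ∀ a ∈ σ, ∀ b ∈ τ, b ≠ T a

/-- Symmetry of the evaluation of a cochain on products of sorted lists. -/
def SymP (T : Z → Z) (mu : Z → ι) (w : List (Z × Z) → ZMod 2) : Prop :=
  ∀ σ τ : List Z, σ.Pairwise (fun a b => mu a < mu b) → τ.Pairwise (fun a b => mu a < mu b) →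
    NoAnti T σ τ → X w σ τ = X w τ σ

/-- The behaviour at the diagonal of the labels in front of an even label. -/
def TieOdd (mu : Z → ι) (x : Z × Z → ZMod 2) : Prop :=
  ∀ z a, mu z < mu a → x (z, z) + x (a, z) = 1 ∧ x (z, z) + x (z, a) = 0

lemma NoAnti.mono {σ τ σ' τ' : List Z} (h : NoAnti T σ τ) (h1 : σ' ⊆ σ) (h2 : τ' ⊆ τ) :
    NoAnti T σ' τ' := fun a ha b hb => h a (h1 ha) b (h2 hb)

lemma headD_mem (a : Z) (as : List Z) : as.headD a ∈ a :: as := by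
  cases as <;> simp

lemma symP_one : SymP T mu (one : List (Z × Z) → ZMod 2) := by
  intro σ τ _ _ _
  rw [← X_swap one σ τ]
  simp only [one_map]

lemma SymP.cup_even {w : List (Z × Z) → ZMod 2} (hw : SymP T mu w)
    {x : Z × Z → ZMod 2} (hx : ∀ a b, b ≠ T a → x (a, b) = x (b, a)) : SymP T mu (cup x w) := by
  intro σ τ hσ hτ h
  rcases σ with _ | ⟨a, as⟩
  · simp
  rcases τ with _ | ⟨b, bs⟩
  · simp
  rw [X_cup, X_cup, hw as (b :: bs) (List.pairwise_cons.1 hσ).2 hτ (h.mono (by simp) (by simp)),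
    hw (a :: as) bs hσ (List.pairwise_cons.1 hτ).2 (h.mono (by simp) (by simp)),
    hx a b (h a (by simp) b (by simp)), hx _ b (h _ (headD_mem a as) b (by simp)),
    hx a _ (h a (by simp) _ (headD_mem b bs))]
  ring

lemma SymP.cut {w : List (Z × Z) → ZMod 2} (hw : SymP T mu w) {x : Z × Z → ZMod 2}
    (hx : ∀ a b, b ≠ T a → x (a, b) = x (b, a)) : SymP T mu (cut x w) := by
  intro σ τ hσ hτ h
  rcases σ with _ | ⟨a, as⟩
  · simp
  rcases τ with _ | ⟨b, bs⟩
  · simp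
  rw [X_cut, X_cut, hw _ _ hσ hτ h, hx a b (h a (by simp) b (by simp))]

lemma signL_symm (hmu : ∀ y z, mu y = mu z → z = y ∨ z = T y) {a b : Z} (h : b ≠ T a) :
    signL mu lam (a, b) = signL mu lam (b, a) := by
  rcases lt_trichotomy (mu a) (mu b) with h' | h' | h'
  · simp [signL, h'.le, h'.not_ge]
  · rw [(hmu a b h').resolve_right h]
  · simp [signL, h'.le, h'.not_ge]

lemma signL_left {z a : Z} (h : mu z < mu a) : signL mu lam (z, a) = lam z := by
  simp [signL, h.le]

lemma signL_right' {z a : Z} (h : mu z < mu a) : signL mu lam (a, z) = lam z := by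
  simp [signL, h.not_ge]

lemma signL_diag (z : Z) : signL mu lam (z, z) = lam z := by simp [signL]

lemma tieOdd_M : TieOdd mu (ordM mu) := by
  intro z a h
  simp [ordM, h.le, h.not_ge]

lemma tieOdd_tau : TieOdd mu (fun p : Z × Z => signL mu lam p + ordM mu p) := by
  intro z a h
  simp only [signL, ordM, h.le, h.not_ge, le_refl, if_true, if_false]
  generalize lam z = x
  revert x; decide

lemma TieOdd.swap {x : Z × Z → ZMod 2} (hx : TieOdd mu x) {a b : Z} (h : mu a ≠ mu b) :
    x (a, b) + x (b, a) = 1 := by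
  rcases lt_or_gt_of_ne h with h | h
  · linear_combination (hx a b h).1 + (hx a b h).2 - two_zero (x (a, a))
  · linear_combination (hx b a h).1 + (hx b a h).2 - two_zero (x (b, b))

lemma lt_headD {a : Z} {as : List Z} (h : (a :: as).Pairwise fun a b => mu a < mu b)
    (has : as ≠ []) : mu a < mu (as.headD a) := by
  rcases as with _ | ⟨a', as⟩
  · exact absurd rfl has
  · exact (List.pairwise_cons.1 h).1 _ (by simp)

lemma signL_headD_left {z : Z} {as : List Z} (h : (z :: as).Pairwise fun a b => mu a < mu b) :
    signL mu lam (as.headD z, z) = lam z := by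
  by_cases has : as = []
  · rw [has]; exact signL_diag z
  · exact signL_right' (lt_headD h has)

lemma signL_headD_right {z : Z} {as : List Z} (h : (z :: as).Pairwise fun a b => mu a < mu b) :
    signL mu lam (z, as.headD z) = lam z := by
  by_cases has : as = []
  · rw [has]; exact signL_diag z
  · exact signL_left (lt_headD h has)

lemma X_cup_signL_tie (w : List (Z × Z) → ZMod 2) {z : Z} {as bs : List Z}
    (ha : (z :: as).Pairwise fun a b => mu a < mu b)
    (hb : (z :: bs).Pairwise fun a b => mu a < mu b) :
    X (cup (signL mu lam) w) (z :: as) (z :: bs) = 0 := by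
  rw [X_cup, signL_headD_left ha, signL_headD_right hb, signL_diag, two_zero]
  ring

/-- The factor `e * L + 1`. -/
def gate (mu : Z → ι) (lam : Z → ZMod 2) (e : ZMod 2) (p : Z × Z) : ZMod 2 :=
  e * signL mu lam p + 1

lemma X_cut_cup_left (e : ZMod 2) (w : List (Z × Z) → ZMod 2) {z a' b' : Z} {as bs : List Z}
    (ha : (z :: a' :: as).Pairwise fun a b => mu a < mu b) :
    X (cut (gate mu lam e) (cup (signL mu lam) w)) (a' :: as) (z :: b' :: bs) =
      (e * lam z + 1) * (lam z + signL mu lam (a', b')) * X w (a' :: as) (b' :: bs) := by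
  have h1 := (List.pairwise_cons.1 ha).1 a' (by simp)
  have h2 : mu z < mu (as.headD a') :=
    (List.pairwise_cons.1 ha).1 _ (by cases as <;> simp)
  rw [X_cut, X_cup, gate, signL_right' h1, signL_right' h2, two_zero]
  simp
  ring

lemma X_cut_cup_right (e : ZMod 2) (w : List (Z × Z) → ZMod 2) {z a' b' : Z} {as bs : List Z}
    (hb : (z :: b' :: bs).Pairwise fun a b => mu a < mu b) :
    X (cut (gate mu lam e) (cup (signL mu lam) w)) (z :: a' :: as) (b' :: bs) =
      (e * lam z + 1) * (lam z + signL mu lam (a', b')) * X w (a' :: as) (b' :: bs) := by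
  have h1 := (List.pairwise_cons.1 hb).1 b' (by simp)
  have h2 : mu z < mu (bs.headD b') :=
    (List.pairwise_cons.1 hb).1 _ (by cases bs <;> simp)
  rw [X_cut, X_cup, gate, signL_left h1, signL_left h2, two_zero]
  simp
  ring

lemma X_tie_symm (e : ZMod 2) (w : List (Z × Z) → ZMod 2) {z : Z} {as bs : List Z}
    (ha : (z :: as).Pairwise fun a b => mu a < mu b)
    (hb : (z :: bs).Pairwise fun a b => mu a < mu b) :
    X (cut (gate mu lam e) (cup (signL mu lam) w)) as (z :: bs) =
      X (cut (gate mu lam e) (cup (signL mu lam) w)) (z :: as) bs := by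
  rcases as with _ | ⟨a', as⟩ <;> rcases bs with _ | ⟨b', bs⟩
  · simp
  · have h2 : mu z < mu (bs.headD b') :=
      (List.pairwise_cons.1 hb).1 _ (by cases bs <;> simp)
    rw [X_nil_left, X_cut, X_cup, signL_left ((List.pairwise_cons.1 hb).1 b' (by simp)),
      signL_left h2, two_zero]
    simp
  · have h2 : mu z < mu (as.headD a') :=
      (List.pairwise_cons.1 ha).1 _ (by cases as <;> simp)
    rw [X_nil_right, X_cut, X_cup, signL_right' ((List.pairwise_cons.1 ha).1 a' (by simp)),
      signL_right' h2, two_zero]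
    simp
  · rw [X_cut_cup_left e w ha, X_cut_cup_right e w hb]

lemma SymP.block (hmu : ∀ y z, mu y = mu z → z = y ∨ z = T y)
    {w : List (Z × Z) → ZMod 2} (hw : SymP T mu w) {x : Z × Z → ZMod 2} (hx : TieOdd mu x)
    (e : ZMod 2) :
    SymP T mu (cup x (ProjMult.cut (gate mu lam e) (cup (signL mu lam) w))) := by
  set v := ProjMult.cut (gate mu lam e) (cup (signL mu lam) w) with hv
  have hvs : SymP T mu v :=
    (hw.cup_even fun a b h => signL_symm hmu h).cut fun a b h => by
      rw [gate, gate, signL_symm hmu h]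
  have tie : ∀ z as bs, (z :: as).Pairwise (fun a b => mu a < mu b) →
      (z :: bs).Pairwise (fun a b => mu a < mu b) → X v (z :: as) (z :: bs) = 0 := by
    intro z as bs ha hb
    rw [hv, X_cut, X_cup_signL_tie w ha hb, mul_zero]
  intro σ τ hσ hτ h
  rcases σ with _ | ⟨a, as⟩
  · simp
  rcases τ with _ | ⟨b, bs⟩
  · simp
  have hmu' : ∀ p ∈ a :: as, ∀ q ∈ b :: bs, p ≠ q → mu p ≠ mu q := fun p hp q hq hpq e =>
    (hmu p q e).elim (fun e => hpq e.symm) (h p hp q hq)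
  rw [X_cup, X_cup, ← hvs as (b :: bs) (List.pairwise_cons.1 hσ).2 hτ (h.mono (by simp) (by simp)),
    ← hvs (a :: as) bs hσ (List.pairwise_cons.1 hτ).2 (h.mono (by simp) (by simp))]
  by_cases hab : a = b
  · subst hab
    rw [hv, X_tie_symm e w hσ hτ, ← hv]
    rcases eq_or_ne as [] with rfl | has
    · rw [hv, ← X_tie_symm e w hσ hτ]; simp
    rcases eq_or_ne bs [] with rfl | hbs
    · simp
    have h1 := hx a _ (lt_headD hσ has)
    have h2 := hx a _ (lt_headD hτ hbs)
    linear_combination (h1.1 + h2.2 - h2.1 - h1.2) * X v (a :: as) bs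
  · have hsw := hx.swap (hmu' a (by simp) b (by simp) hab)
    have k1 : (x (a, b) + x (as.headD a, b) + x (b, a) + x (b, as.headD a)) *
        X v as (b :: bs) = 0 := by
      rcases as with _ | ⟨a', as⟩
      · simp
      by_cases h' : a' = b
      · subst h'
        rw [tie _ _ _ (List.pairwise_cons.1 hσ).2 hτ, mul_zero]
      · have := hx.swap (hmu' a' (by simp) b (by simp) h')
        simp only [List.headD_cons]
        linear_combination (hsw + this + two_zero 1) * X v (a' :: as) (b :: bs)
    have k2 : (x (a, b) + x (a, bs.headD b) + x (b, a) + x (bs.headD b, a)) *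
        X v (a :: as) bs = 0 := by
      rcases bs with _ | ⟨b', bs⟩
      · simp
      by_cases h' : a = b'
      · subst h'
        rw [tie _ _ _ hσ (List.pairwise_cons.1 hτ).2, mul_zero]
      · have := hx.swap (hmu' a (by simp) b' (by simp) h')
        simp only [List.headD_cons]
        linear_combination (hsw + this + two_zero 1) * X v (a :: as) (b' :: bs)
    refine CharTwo.add_eq_zero.1 ?_
    linear_combination k1 + k2

lemma X_block_diag (w : List (Z × Z) → ZMod 2) {x : Z × Z → ZMod 2} (hx : TieOdd mu x)
    (e : ZMod 2) (W : List Z → ZMod 2) {z : Z} {as : List Z}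
    (ha : (z :: as).Pairwise fun a b => mu a < mu b) (hW : X w as as = W as) :
    X (cup x (cut (gate mu lam e) (cup (signL mu lam) w))) (z :: as) (z :: as) =
      (e * lam z + 1) * cup lam W (z :: as) := by
  rcases as with _ | ⟨a', as⟩
  · rw [X_cup]; simp
  · have h1 := hx z _ (lt_headD ha (by simp))
    rw [X_cup, h1.1, h1.2, X_cut_cup_left e w ha, signL_diag, hW, cup_cons]
    ring

/-- The words on which the square is evaluated. -/
def word (mu : Z → ι) (lam : Z → ZMod 2) (q r : ℕ) : List (Z × Z → ZMod 2) :=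
  (List.replicate q [fun p : Z × Z => signL mu lam p + ordM mu p, signL mu lam]).flatten ++
    List.replicate r (signL mu lam)

lemma gate_zero (w : List (Z × Z) → ZMod 2) (x : Z × Z → ZMod 2) :
    cut (gate mu lam 0) (cup x w) = cup x w := by
  funext l
  rcases l with _ | ⟨a, l⟩ <;> simp [gate]

lemma cups_word_succ (q r : ℕ) : cups (word mu lam (q + 1) r) one =
    cup (fun p : Z × Z => signL mu lam p + ordM mu p)
      (cut (gate mu lam 0) (cup (signL mu lam) (cups (word mu lam q r) one))) := by
  rw [gate_zero, word, List.replicate_succ]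
  rfl

lemma symP_word (hmu : ∀ y z, mu y = mu z → z = y ∨ z = T y)
    (q r : ℕ) : SymP T mu (cups (word mu lam q r) one) := by
  induction q with
  | zero =>
    simp only [word, List.replicate_zero, List.flatten_nil, List.nil_append]
    induction r with
    | zero => exact symP_one
    | succ r ih =>
      rw [List.replicate_succ, cups_cons]
      exact ih.cup_even fun a b h => signL_symm hmu h
  | succ q ih =>
    rw [cups_word_succ]
    exact ih.block hmu tieOdd_tau 0

lemma X_word_diag (q r : ℕ) {σ : List Z} (hσ : σ.Pairwise fun a b => mu a < mu b) :
    X (cups (word mu lam q r) one) σ σ =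
      if r = 0 then cups (List.replicate q lam) one σ else 0 := by
  induction q generalizing σ with
  | zero =>
    simp only [word, List.replicate_zero, List.flatten_nil, List.nil_append, cups_nil]
    rcases σ with _ | ⟨z, as⟩
    · simp
    rcases r with _ | r
    · rw [List.replicate_zero, cups_nil, if_pos rfl]
      have e : ∀ t : List (Z × Z), t ≠ [] → one ((z, z) :: t) = 0 := by
        intro t ht
        rcases t with _ | ⟨a, t⟩
        · exact absurd rfl ht
        · rfl
      have z1 : ∀ σ τ : List Z, X (fun s => one ((z, z) :: s)) σ τ = 0 := by
        intro σ τ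
        rw [X_congr (w := fun _ => 0) fun s hs => e s (ne_nil_of_mem_sh hs)]
        simp [X]
      rw [X_cons, z1, z1]
      rcases as with _ | ⟨a, as⟩ <;> simp [bothNil]
    · rw [List.replicate_succ, cups_cons, X_cup_signL_tie _ hσ hσ]
      simp
  | succ q ih =>
    rcases σ with _ | ⟨z, as⟩
    · simp [List.replicate_succ]
    rw [cups_word_succ, X_block_diag _ tieOdd_tau 0
      (fun σ => if r = 0 then cups (List.replicate q lam) one σ else 0) hσ
      (ih (List.pairwise_cons.1 hσ).2), List.replicate_succ, cups_cons]
    split_ifs with h <;> rcases as with _ | ⟨a, as⟩ <;> simp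

namespace Doubling

variable {nu : Z × Z → ZMod 2} {c : List (List Z)} {D : ℕ} (H : Doubling T lam mu nu c D)
include H

lemma Phi_word {u : Z × Z → ZMod 2} (hu : ∀ a b, u (a, b) = u (b, a))
    (hna : ∀ σ ∈ c, ∀ τ ∈ c, ∀ a ∈ σ, ∀ b ∈ τ, u (a, b) ≠ 0 → NoAnti T σ τ)
    (hdiag : ∀ σ ∈ c, ∀ z ∈ σ, u (z, z) = 1) (q r : ℕ) :
    Phi c (cut u (cup (ordM mu) (cut (fun p => signL mu lam p + 1)
      (cups (signL mu lam :: word mu lam q r) one)))) =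
      if r = 0 then pr c (cut (fun z => lam z + 1) (cups (List.replicate (q + 1) lam) one))
        else 0 := by
  have hg : (fun p : Z × Z => signL mu lam p + 1) = gate mu lam 1 := by
    funext p; simp [gate]
  rw [hg, cups_cons]
  set v := cup (ordM mu) (cut (gate mu lam 1) (cup (signL mu lam) (cups (word mu lam q r) one)))
    with hv
  have hs : SymP T mu v := (symP_word H.mu_inj q r).block H.mu_inj tieOdd_M 1
  have h1 : ∀ σ ∈ c, ∀ τ ∈ c, X (cut u v) σ τ = X (cut u v) τ σ := by
    intro σ hσ τ hτ
    rcases σ with _ | ⟨a, as⟩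
    · simp
    rcases τ with _ | ⟨b, bs⟩
    · simp
    rw [X_cut, X_cut, ← hu a b]
    by_cases h : u (a, b) = 0
    · rw [h]; simp
    · rw [hs _ _ (H.sorted _ hσ) (H.sorted _ hτ) (hna _ hσ _ hτ a (by simp) b (by simp) h)]
  rw [Phi, pr_diag c (fun σ τ => X (cut u v) σ τ) h1]
  have h2 : ∀ σ ∈ c, X (cut u v) σ σ =
      if r = 0 then cut (fun z => lam z + 1) (cups (List.replicate (q + 1) lam) one) σ else 0 := by
    intro σ hσ
    rcases σ with _ | ⟨z, as⟩
    · simp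
    rw [X_cut, hdiag _ hσ z (by simp), one_mul, hv, X_block_diag _ tieOdd_M 1
      (fun σ => if r = 0 then cups (List.replicate q lam) one σ else 0) (H.sorted _ hσ)
      (X_word_diag q r (List.pairwise_cons.1 (H.sorted _ hσ)).2), one_mul,
      List.replicate_succ, cups_cons, cut_cons]
    split_ifs with h <;> rcases as with _ | ⟨a, as⟩ <;> simp
  rw [pr_congr h2]
  split_ifs
  · rfl
  · exact pr_zero c

end Doubling

end Diagonal

/-! ### The evaluation of the localized square -/

section Evaluation

variable {Y : Type*} {P : Y → Prop} {S T : Y → Y} {A : (List Y → ZMod 2) → ZMod 2}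
  {M L : Y → ZMod 2}

lemma exists_commutator (rs : List (Y → ZMod 2)) (L : Y → ZMod 2)
    (hL : SemiOn P T L) (hrs : ∀ r ∈ rs, SemiOn P T r) {w : List Y → ZMod 2}
    (hw : InvOn P T w) :
    ∃ q, InvOn P T q ∧ cups rs (cut L w) = fun l => cut L (cups rs w) l + q l := by
  induction rs with
  | nil => exact ⟨fun _ => 0, fun _ _ _ => rfl, by simp⟩
  | cons r rs ih =>
    have hrs' : ∀ x ∈ rs, SemiOn P T x := fun x hx => hrs x (by simp [hx])
    obtain ⟨q, hq, e⟩ := ih hrs'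
    refine ⟨fun l => swapHom L r (cups rs w) l + cup r q l, fun l hl h => ?_, ?_⟩
    · simp only [(hw.cups hrs').swapHom hL (hrs r (by simp)) l hl h,
        hq.cup (hrs r (by simp)) l hl h]
    · rw [cups_cons, e, cup_add, cups_cons]
      funext l
      rcases l with _ | ⟨a, _ | ⟨b, l⟩⟩
      · simp [swapHom]
      · simp [swapHom]
      · simp only [cup_cons, cut_cons, swapHom]
        linear_combination -two_zero (L a * (r a + r b) * cups rs w (b :: l))

lemma Labels.eval_cut_cups (h : Labels P S T M L) (hA : InvCycle P S T A)
    {rs zs : List (Y → ZMod 2)} (hrs : ∀ r ∈ rs, SemiOn P T r) (hzs : ∀ r ∈ zs, SemiOn P T r) :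
    A (cut (fun p => M p + 1) (cups rs (cut (fun p => L p + 1) (cups zs one)))) =
      ev A M L (cups (rs ++ zs) one) := by
  obtain ⟨q, hq, e⟩ := exists_commutator (P := P) (T := T) rs (fun p => L p + 1)
    ⟨1, fun p hp => by simp only [h.L_trans p hp]⟩ hrs (invOn_one.cups hzs)
  rw [e, cut_add, hA.add, ev, cups_append]
  have : A (fun l => cut (fun p => M p + 1) q l) = 0 :=
    h.kill_trans hA (hq.cut fun p hp => by rw [h.M_trans p hp])
  rw [this, add_zero]

end Evaluation

section Square

variable {Z ι : Type*} [LinearOrder ι] {T : Z → Z} {lam : Z → ZMod 2} {mu : Z → ι}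
  {nu : Z × Z → ZMod 2} {c : List (List Z)} {D : ℕ}

lemma jump_add_one (v : List (Z × Z) → ZMod 2) :
    jump (fun p => nu p + 1) c v = jump nu c v := by
  rw [jump, jump, cup_add_const]

lemma perm_flatten {α : Type*} (x y : α) (q : ℕ) :
    (List.replicate q [x, y]).flatten.Perm (List.replicate q x ++ List.replicate q y) := by
  induction q with
  | zero => simp
  | succ q ih =>
    simp only [List.replicate_succ, List.flatten_cons, List.cons_append, List.nil_append]
    exact ((ih.cons y).trans List.perm_middle.symm).cons x

lemma perm_word {α : Type*} (x y : α) (q r : ℕ) :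
    (List.replicate (q + 1 + r) x ++ List.replicate q y).Perm
      (x :: ((List.replicate q [y, x]).flatten ++ List.replicate r x)) := by
  have h1 := (perm_flatten y x q).append_right (List.replicate r x)
  rw [List.append_assoc, ← List.replicate_add] at h1
  have h2 := (h1.trans List.perm_append_comm).cons x
  have e : List.replicate (q + 1 + r) x = x :: List.replicate (q + r) x := by
    rw [← List.replicate_succ, Nat.add_right_comm]
  rw [e]
  exact h2.symm

namespace Doubling

variable (H : Doubling T lam mu nu c D)
include H

omit H in
lemma d_cut_cut (g : Z × Z → ZMod 2) (zs : List (Z × Z → ZMod 2)) :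
    d (cut (fun p => ordM mu p + 1) (cut (fun p => g p + 1) (cups zs one))) =
      fun l => cup (ordM mu) (cut (fun p => g p + 1) (cups zs one)) l +
        cut (fun p => ordM mu p + 1) (cup g (cups zs one)) l := by
  funext l
  rw [d_cut _ rfl, cup_add_const]
  congr 2
  funext l
  rw [d_cut _ (cups_apply_nil _ one_nil), d_cups_one, cup_add_const]
  rcases l with _ | ⟨a, l⟩ <;> simp

lemma jump_cut_cut (g u : Z × Z → ZMod 2) (zs : List (Z × Z → ZMod 2))
    (hu : ∀ p, u (Prod.map T T p) = u p)
    (hg : ∀ p, g (Prod.map T T p) = g p + 1)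
    (hz : ∀ z ∈ zs, ∃ e, ∀ p, z (Prod.map T T p) = z p + e)
    (hj : ∀ v, jump u c v = jump nu c v) :
    jump nu c (cut (fun p => ordM mu p + 1) (cut (fun p => g p + 1) (cups zs one))) =
      Phi c (cut u (cup (ordM mu) (cut (fun p => g p + 1) (cups zs one)))) := by
  set v := cut (fun p => ordM mu p + 1) (cut (fun p => g p + 1) (cups zs one)) with hv
  have h := H.Phi_d (w := cut u v) rfl
  rw [funext (d_cut u (w := v) rfl), Phi_add, hv, d_cut_cut, cut_add, Phi_add, ← hv] at h
  have h0 : Phi c (fun l => cut u (cut (fun p => ordM mu p + 1) (cup g (cups zs one))) l) = 0 := by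
    refine H.Phi_kill rfl fun l => ?_
    rcases eq_or_ne l [] with rfl | hl
    · rfl
    have hone : InvOn (fun _ : Z × Z => True) (Prod.map T T) one := invOn_one
    refine InvOn.cut (P := fun _ => True) (InvOn.cut ?_ fun p _ => ?_) (fun p _ => hu p) l hl
      (by simp)
    · refine (hone.cups fun z hzz => ?_).cup ⟨1, fun p _ => hg p⟩
      obtain ⟨e, he⟩ := hz z hzz
      exact ⟨e, fun p _ => he p⟩
    · rw [H.ordM_T]
  rw [h0, add_zero] at h
  rw [← hj]
  exact CharTwo.add_eq_zero.1 h

lemma word_T (zs : List (Z × Z → ZMod 2))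
    (hzs : ∀ z ∈ zs, z = signL mu lam ∨ z = fun p => signL mu lam p + ordM mu p) :
    ∀ z ∈ zs, ∃ e, ∀ p, z (Prod.map T T p) = z p + e := by
  intro z hz
  rcases hzs z hz with rfl | rfl
  · exact ⟨1, H.signL_T⟩
  · exact ⟨1, fun p => by simp only [H.signL_T, H.ordM_T]; ring⟩

lemma ev_left (q r : ℕ) :
    ev (jump nu c) (ordM mu) (signL mu lam) (cups (signL mu lam :: word mu lam q r) one) =
      if r = 0 then pr c (cut (fun z => lam z + 1) (cups (List.replicate (q + 1) lam) one))
        else 0 := by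
  rw [ev, H.jump_cut_cut (signL mu lam) (fun p => nu p + 1) _
    (fun p => by rw [← Prod.mk.eta (p := p), Prod.map_apply, H.nu_T]) H.signL_T ?_ jump_add_one]
  · refine H.Phi_word (fun a b => by rw [H.nu_swap]) ?_ ?_ q r
    · intro σ hσ τ hτ a ha b hb h
      have : nu (a, b) = 0 := by
        generalize nu (a, b) = x at h
        revert h; revert x; decide
      exact H.near σ hσ τ hτ a ha b hb this
    · intro σ _ z _
      simp [H.nu_diag]
  · refine H.word_T _ fun z hz => ?_
    simp only [word, List.mem_cons, List.mem_append, List.mem_flatten, List.mem_replicate] at hz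
    rcases hz with hz | ⟨l, ⟨-, rfl⟩, hz⟩ | ⟨-, hz⟩
    · exact Or.inl hz
    · simp only [List.mem_cons, List.not_mem_nil, or_false] at hz
      exact hz.symm
    · exact Or.inl hz

lemma ev_right (q r : ℕ) :
    ev (jump nu c) (ordM mu) (signL mu lam)
      (cups ((fun p => signL mu lam p + ordM mu p) :: ((List.replicate q [signL mu lam,
        fun p : Z × Z => signL mu lam p + ordM mu p]).flatten ++
          List.replicate r (fun p : Z × Z => signL mu lam p + ordM mu p))) one) =
      if r = 0 then pr c (cut (fun z => lam z + 1) (cups (List.replicate (q + 1) lam) one))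
        else 0 := by
  set tau := fun p : Z × Z => signL mu lam p + ordM mu p with htau
  set zs := tau :: ((List.replicate q [signL mu lam, tau]).flatten ++ List.replicate r tau)
    with hzs
  have hcut : ∀ v : List (Z × Z) → ZMod 2,
      cut (fun p => ordM mu p + 1) (cut (fun p => signL mu lam p + 1) v) =
        cut (fun p => ordM mu p + 1) (cut (fun p => tau p + 1) v) := by
    intro v
    funext l
    rcases l with _ | ⟨a, l⟩
    · rfl
    · simp only [cut_cons, htau]
      generalize ordM mu a = m
      generalize signL mu lam a = s
      generalize v (a :: l) = y
      revert m s y; decide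
  have hmem : ∀ z ∈ zs, z = signL mu lam ∨ z = tau := by
    intro z hz
    simp only [hzs, List.mem_cons, List.mem_append, List.mem_flatten, List.mem_replicate] at hz
    rcases hz with hz | ⟨l, ⟨-, rfl⟩, hz⟩ | ⟨-, hz⟩
    · exact Or.inr hz
    · simpa using hz
    · exact Or.inr hz
  rw [ev, hcut, H.jump_cut_cut tau nu zs (fun p => H.nu_T p.1 p.2)
    (fun p => by simp only [htau, H.signL_T, H.ordM_T]; ring) (H.word_T _ hmem) fun _ => rfl,
    ← H.Phi_map_right]
  have hL : (fun p => signL mu lam (Prod.map id T p)) = tau := funext H.signL_right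
  have hTau : (fun p => tau (Prod.map id T p)) = signL mu lam := by
    funext p
    simp only [htau, H.signL_right, H.ordM_right]
    linear_combination two_zero (ordM mu p)
  have hM : (fun p => ordM mu (Prod.map id T p)) = ordM mu := funext H.ordM_right
  have hzs' : zs.map (fun x p => x (Prod.map id T p)) = signL mu lam :: word mu lam q r := by
    simp only [hzs, word, List.map_cons, List.map_append, List.map_flatten, List.map_replicate,
      List.map_nil, hL, hTau, ← htau]
  have hpull : (fun l => cut nu (cup (ordM mu) (cut (fun p => tau p + 1) (cups zs one)))
      (l.map (Prod.map id T))) = cut (fun p => nu (Prod.map id T p)) (cup (ordM mu)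
        (cut (fun p => signL mu lam p + 1) (cups (signL mu lam :: word mu lam q r) one))) := by
    rw [← hzs']
    conv_rhs => rw [← hTau]
    conv_rhs => rw [← hM]
    funext l
    rw [cut_map]
    congr 1
    funext l
    rw [cup_map]
    congr 1
    funext l
    rw [cut_map]
    congr 1
    funext l
    rw [cups_map]
    congr 1
    funext l
    rw [one_map]
  rw [hpull]
  refine H.Phi_word (fun a b => ?_) ?_ ?_ q r
  · simp only [Prod.map_apply, id]
    rw [← H.nu_T a (T b), H.T_T, H.nu_swap]
  · intro σ hσ τ hτ a ha b hb h
    refine H.far_T σ hσ τ hτ a ha b hb ?_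
    simp only [Prod.map_apply, id] at h
    generalize nu (a, T b) = x at h
    revert h; revert x; decide
  · intro σ hσ z hz
    exact H.nu_anti σ hσ z hz

lemma ev_base (p q : ℕ) (hpq : p + q + 1 = 2 * D) :
    ev (jump nu c) (ordM mu) (signL mu lam) (cups (List.replicate p (signL mu lam) ++
      List.replicate q (fun y => signL mu lam y + ordM mu y)) one) =
      if p = D ∨ q = D then 1 else 0 := by
  have hL := H.labels
  have hA := H.invCycle
  have hsemi : ∀ x ∈ List.replicate p (signL mu lam) ++
      List.replicate q (fun y => signL mu lam y + ordM mu y),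
      SemiOn (OffDiag T) Prod.swap x ∧ SemiOn (OffDiag T) (Prod.map T T) x := by
    intro x hx
    simp only [List.mem_append, List.mem_replicate] at hx
    rcases hx with ⟨-, rfl⟩ | ⟨-, rfl⟩
    exacts [hL.semi_L, hL.semi_add]
  rcases lt_trichotomy p q with h | h | h
  · obtain ⟨r, rfl⟩ : ∃ r, q = p + 1 + r := ⟨q - (p + 1), by omega⟩
    rw [hL.ev_perm hA (List.perm_append_comm.trans (perm_word _ _ p r))
      (fun x hx => (hsemi x hx).1) (fun x hx => (hsemi x hx).2), H.ev_right]
    rcases Nat.eq_zero_or_pos r with rfl | hr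
    · have : p + 1 = D := by omega
      rw [if_pos rfl, if_pos (by omega), this, H.odd]
    · rw [if_neg (by omega), if_neg (by omega)]
  · omega
  · obtain ⟨r, rfl⟩ : ∃ r, p = q + 1 + r := ⟨p - (q + 1), by omega⟩
    have := H.ev_left q r
    rw [word] at this
    rw [hL.ev_perm hA (perm_word _ _ q r)
      (fun x hx => (hsemi x hx).1) (fun x hx => (hsemi x hx).2), this]
    rcases Nat.eq_zero_or_pos r with rfl | hr
    · have : q + 1 = D := by omega
      rw [if_pos rfl, if_pos (by omega), this, H.odd]
    · rw [if_neg (by omega), if_neg (by omega)]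

/-- The localized square, cut down by odd labels, is again odd. -/
theorem jump_eval {N D' : ℕ} (hD : N + 1 + D' = 2 * D) (hD' : D ≤ N + 1)
    (rs : List (Z × Z → ZMod 2)) (hN : rs.length = N)
    (hrS : ∀ r ∈ rs, ∀ p, OffDiag T p → r p.swap = r p + 1)
    (hrT : ∀ r ∈ rs, ∀ p, OffDiag T p → r (Prod.map T T p) = r p) :
    jump nu c (cut (fun p => ordM mu p + 1) (cups rs (cut (fun p => signL mu lam p + 1)
      (cups (List.replicate D' (signL mu lam)) one)))) = (((N + 1).choose (D - D') : ℕ) : ZMod 2) := by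
  have hL := H.labels
  have hA := H.invCycle
  have hz : ∀ x ∈ List.replicate D' (signL mu lam), x = signL mu lam := fun x hx =>
    (List.mem_replicate.1 hx).2
  rw [hL.eval_cut_cups hA (fun r hr => ⟨0, fun p hp => by rw [hrT r hr p hp, add_zero]⟩)
    (fun r hr => by rw [hz r hr]; exact hL.semi_L.2),
    hL.ev_replicate hA rs _ hrS hrT (fun r hr => by rw [hz r hr]; exact hL.semi_L.1)
    (fun r hr => by rw [hz r hr]; exact hL.semi_L.2), hN]
  have := hL.ev_pascal hA (D := D) H.ev_base N D' 0 (by omega)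
  rw [List.replicate_zero, List.append_nil, if_pos (by omega)] at this
  exact this

end Doubling

end Square

/-! ### Cap products of chains -/

section Caps

variable {Y Y' : Type*}

open Classical in
/-- The faces behind the first edge of a list, if `x` jumps along this edge. -/
noncomputable def capL (x : Y → ZMod 2) : List Y → List (List Y)
  | a :: b :: t => if x a = x b then [] else [b :: t]
  | _ => []

/-- The cap product with the coboundary of `x`. -/
noncomputable def cap (x : Y → ZMod 2) (c : List (List Y)) : List (List Y) := c.flatMap (capL x)

/-- Iterated cap products. -/
noncomputable def caps : List (Y → ZMod 2) → List (List Y) → List (List Y)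
  | [], c => c
  | x :: xs, c => caps xs (cap x c)

open Classical in
/-- The lists whose first entry does not lie in the zero set of `u`. -/
noncomputable def sel (u : Y → ZMod 2) (c : List (List Y)) : List (List Y) :=
  c.filter fun l => cut u (fun _ => 1) l ≠ 0

lemma pr_flatMap (c : List (List Y)) (g : List Y → List (List Y')) (w : List Y' → ZMod 2) :
    pr (c.flatMap g) w = pr c fun l => pr (g l) w := by
  induction c with
  | nil => rfl
  | cons l c ih =>
    simp only [pr, List.flatMap_cons, List.map_append, List.sum_append, List.map_cons,
      List.sum_cons] at ih ⊢
    rw [ih]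

lemma pr_cap (x : Y → ZMod 2) (c : List (List Y)) (w : List Y → ZMod 2) :
    pr (cap x c) w = pr c (cup x w) := by
  rw [cap, pr_flatMap]
  congr 1
  funext l
  rcases l with _ | ⟨a, _ | ⟨b, l⟩⟩
  · rfl
  · rfl
  · rw [cup_cons, capL]
    split_ifs with h
    · rw [h, two_zero, zero_mul]; rfl
    · have : x a + x b = 1 := by
        generalize x a = p at h ⊢
        generalize x b = q at h ⊢
        revert h; revert p q; decide
      rw [this, one_mul]
      simp [pr]

lemma pr_caps (xs : List (Y → ZMod 2)) (c : List (List Y)) (w : List Y → ZMod 2) :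
    pr (caps xs c) w = pr c (cups xs w) := by
  induction xs generalizing c with
  | nil => rfl
  | cons x xs ih => rw [caps, ih, pr_cap, cups_cons]

lemma pr_sel (u : Y → ZMod 2) (c : List (List Y)) (w : List Y → ZMod 2) :
    pr (sel u c) w = pr c (cut u w) := by
  induction c with
  | nil => rfl
  | cons l c ih =>
    simp only [pr, sel, List.map_cons, List.sum_cons] at ih ⊢
    rw [← ih]
    rcases l with _ | ⟨a, l⟩
    · simp
    · rcases eq_or_ne (u a) 0 with h | h
      · simp [h]
      · have h1 : u a = 1 := by
          generalize u a = p at h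
          revert h; revert p; decide
        simp [h1]

lemma pr_map (g : List Y → List Y') (c : List (List Y)) (w : List Y' → ZMod 2) :
    pr (c.map g) w = pr c fun l => w (g l) := by
  simp [pr, Function.comp_def]

lemma mem_cap {x : Y → ZMod 2} {c : List (List Y)} {l : List Y} (h : l ∈ cap x c) :
    ∃ s ∈ c, l <:+ s ∧ ∃ p ∈ s, ∃ q ∈ s, x p ≠ x q := by
  obtain ⟨s, hs, h⟩ := List.mem_flatMap.1 h
  refine ⟨s, hs, ?_⟩
  rcases s with _ | ⟨a, _ | ⟨b, s⟩⟩
  · simp [capL] at h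
  · simp [capL] at h
  · rw [capL] at h
    split_ifs at h with e
    · simp at h
    · rw [List.mem_singleton] at h
      subst h
      exact ⟨List.suffix_cons _ _, a, by simp, b, by simp, e⟩

lemma mem_caps {xs : List (Y → ZMod 2)} {c : List (List Y)} {l : List Y} (h : l ∈ caps xs c) :
    ∃ s ∈ c, l <:+ s ∧ ∀ x ∈ xs, ∃ p ∈ s, ∃ q ∈ s, x p ≠ x q := by
  induction xs generalizing c with
  | nil => exact ⟨l, h, List.suffix_refl _, by simp⟩
  | cons x xs ih =>
    obtain ⟨s, hs, hls, hx⟩ := ih h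
    obtain ⟨s', hs', hss, hx'⟩ := mem_cap hs
    refine ⟨s', hs', hls.trans hss, fun y hy => ?_⟩
    rcases List.mem_cons.1 hy with rfl | hy
    · exact hx'
    · obtain ⟨p, hp, q, hq, e⟩ := hx y hy
      exact ⟨p, hss.subset hp, q, hss.subset hq, e⟩

lemma mem_of_mem_sel {u : Y → ZMod 2} {c : List (List Y)} {l : List Y} (h : l ∈ sel u c) :
    l ∈ c := (List.mem_filter.1 h).1

/-- The chain of all staircase paths in the square of a chain. -/
def square (c : List (List Y)) : List (List (Y × Y)) := c.flatMap fun σ => c.flatMap (sh σ)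

lemma pr_square (c : List (List Y)) (w : List (Y × Y) → ZMod 2) : pr (square c) w = Phi c w := by
  rw [square, pr_flatMap, Phi]
  congr 1
  funext σ
  rw [pr_flatMap]
  rfl

lemma mem_square {c : List (List Y)} {s : List (Y × Y)} (h : s ∈ square c) :
    ∃ σ ∈ c, ∃ τ ∈ c, s ∈ sh σ τ := by
  simpa [square] using h

end Caps

lemma choose_two_pow_sub_one (l j : ℕ) (hj : j ≤ 2 ^ l - 1) :
    (((2 ^ l - 1).choose j : ℕ) : ZMod 2) = 1 := by
  induction j with
  | zero => simp
  | succ j ih =>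
    have ih := ih (by omega)
    have h : 2 ∣ (2 ^ l).choose (j + 1) :=
      Nat.prime_two.dvd_choose_pow (by omega) (by omega)
    have e : 2 ^ l = (2 ^ l - 1) + 1 := by omega
    rw [e, Nat.choose_succ_succ] at h
    have h0 := (ZMod.natCast_eq_zero_iff _ 2).2 h
    push_cast at h0 ⊢
    rw [ih] at h0
    rw [← CharTwo.add_eq_zero.1 h0]

/-! ### Symmetric cycles with many almost coinciding points -/

section Metric

variable {E : Type*} [NormedAddCommGroup E] [NormedSpace ℝ E] {N : ℕ}

/-- A `D`-dimensional antipodally symmetric cycle of points `z`, each carrying a cluster of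
`K` points of the unit sphere near `pos z` whose images under `F` are close to `h z`. -/
structure Sys (F : Metric.sphere (0 : E) 1 → Fin N → ℝ) (D K : ℕ) (om rho eta : ℝ) {Z : Type}
    (T : Z → Z) (lam : Z → ZMod 2) (rk : Z → ℕ) (pos : Z → E) (h : Z → Fin N → ℝ)
    (c : List (List Z)) : Prop where
  T_T : ∀ z, T (T z) = z
  lam_T : ∀ z, lam (T z) = lam z + 1
  rk_T : ∀ z, rk (T z) = rk z
  pos_T : ∀ z, pos (T z) = -pos z
  h_T : ∀ z, h (T z) = h z
  sorted : ∀ σ ∈ c, σ.Pairwise fun a b => rk a < rk b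
  fine_pos : ∀ σ ∈ c, ∀ a ∈ σ, ∀ b ∈ σ, dist (pos a) (pos b) ≤ eta
  fine_h : ∀ σ ∈ c, ∀ a ∈ σ, ∀ b ∈ σ, dist (h a) (h b) ≤ eta
  inv : ∀ w : List Z → ZMod 2, pr c (fun l => w (l.map T)) = pr c w
  cyc : ∀ w : List Z → ZMod 2, w [] = 0 → pr c (d w) = 0
  odd : pr c (cut (fun z => lam z + 1) (cups (List.replicate D lam) one)) = 1
  leaf : ∀ σ ∈ c, ∀ a ∈ σ, ∃ x : Fin K → Metric.sphere (0 : E) 1,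
    (∀ i, dist (x i : E) (pos a) ≤ om) ∧ (∀ i, dist (F (x i)) (h a) ≤ eta) ∧
      ∀ i j, i ≠ j → rho ≤ dist (x i) (x j)

/-- Existence of symmetric cycles at every scale. -/
def HasSys (F : Metric.sphere (0 : E) 1 → Fin N → ℝ) (D K : ℕ) : Prop :=
  ∀ om > 0, ∃ rho > 0, ∀ eta > 0, ∃ (Z : Type) (T : Z → Z) (lam : Z → ZMod 2) (rk : Z → ℕ)
    (pos : Z → E) (h : Z → Fin N → ℝ) (c : List (List Z)),
    Sys F D K om rho eta T lam rk pos h c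

/-- The ranks refined to a linear order on orbits. -/
def ordMu {Z : Type} [LinearOrder Z] (T : Z → Z) (rk : Z → ℕ) (z : Z) : ℕ ×ₗ Z :=
  toLex (rk z, min z (T z))

open Classical in
/-- The indicator of pairs at distance at least `e`. -/
noncomputable def farNu {Z : Type} (pos : Z → E) (e : ℝ) (p : Z × Z) : ZMod 2 :=
  if dist (pos p.1) (pos p.2) < e then 0 else 1

omit [NormedSpace ℝ E] in
lemma farNu_eq_zero {Z : Type} {pos : Z → E} {e : ℝ} {p : Z × Z} :
    farNu pos e p = 0 ↔ dist (pos p.1) (pos p.2) < e := by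
  unfold farNu; split_ifs with h <;> simp [h]

omit [NormedSpace ℝ E] in
lemma farNu_eq_one {Z : Type} {pos : Z → E} {e : ℝ} {p : Z × Z} :
    farNu pos e p = 1 ↔ e ≤ dist (pos p.1) (pos p.2) := by
  unfold farNu; split_ifs with h
  · simp [h]
  · simpa using h

variable {F : Metric.sphere (0 : E) 1 → Fin N → ℝ} {D K : ℕ} {om rho eta : ℝ} {Z : Type}
    {T : Z → Z} {lam : Z → ZMod 2} {rk : Z → ℕ} {pos : Z → E} {h : Z → Fin N → ℝ}
    {c : List (List Z)}

namespace Sys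

variable (H : Sys F D K om rho eta T lam rk pos h c)
include H

omit [NormedSpace ℝ E] in
lemma norm_pos (hK : 0 < K) {σ : List Z} (hσ : σ ∈ c) {a : Z} (ha : a ∈ σ) :
    1 - om ≤ ‖pos a‖ := by
  obtain ⟨x, h1, -⟩ := H.leaf σ hσ a ha
  have h2 := h1 ⟨0, hK⟩
  have h3 : ‖(x ⟨0, hK⟩ : E)‖ = 1 := by simp
  rw [dist_eq_norm] at h2
  have := norm_sub_norm_le (x ⟨0, hK⟩ : E) (pos a)
  linarith

omit [NormedSpace ℝ E] in
lemma dist_close {σ : List Z} (hσ : σ ∈ c) {τ : List Z} (hτ : τ ∈ c) {a a' b b' : Z} (ha : a ∈ σ)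
    (ha' : a' ∈ σ) (hb : b ∈ τ) (hb' : b' ∈ τ) :
    dist (pos a) (pos b) ≤ dist (pos a') (pos b') + 2 * eta := by
  have h1 := H.fine_pos σ hσ a ha a' ha'
  have h2 := H.fine_pos τ hτ b' hb' b hb
  have := dist_triangle4 (pos a) (pos a') (pos b') (pos b)
  linarith

lemma doubling [LinearOrder Z] (hK : 0 < K) {e : ℝ} (he : 0 < e) (he' : e ≤ 1 / 2)
    (hom : om ≤ e / 8) (heta : eta ≤ e / 16) :
    Doubling T lam (ordMu T rk) (farNu pos e) c D where
  T_T := H.T_T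
  lam_T := H.lam_T
  mu_T z := by simp [ordMu, H.T_T, H.rk_T, min_comm]
  mu_inj y z hyz := by
    have h1 : min y (T y) = min z (T z) := congrArg (fun p => (ofLex p).2) hyz
    rcases min_choice y (T y) with h2 | h2 <;> rcases min_choice z (T z) with h3 | h3 <;>
      rw [h2, h3] at h1
    · exact Or.inl h1.symm
    · exact Or.inr (by rw [h1, H.T_T])
    · exact Or.inr h1.symm
    · left; rw [← H.T_T z, ← h1, H.T_T]
  sorted σ hσ := (H.sorted σ hσ).imp fun hab => Prod.Lex.toLex_lt_toLex.2 (Or.inl hab)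
  nu_swap y z := by simp only [farNu, dist_comm]
  nu_T y z := by simp only [farNu, H.pos_T, dist_neg_neg]
  near σ hσ τ hτ a ha b hb hab a' ha' b' hb' hbad := by
    have h1 := farNu_eq_zero.1 hab
    have h2 := H.dist_close hσ hτ ha' ha hb' hb
    have h3 := H.norm_pos hK hσ ha'
    rw [hbad, H.pos_T, dist_eq_norm, sub_neg_eq_add, ← two_smul ℝ, norm_smul] at h2
    norm_num at h2
    simp only at h1
    linarith
  far σ hσ τ hτ a ha b hb hab a' ha' b' hb' hbad := by
    have h1 := farNu_eq_one.1 hab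
    have h2 := H.dist_close hσ hτ ha ha' hb hb'
    rw [hbad, dist_self] at h2
    simp only at h1
    linarith
  far_T σ hσ τ hτ a ha b hb hab a' ha' b' hb' hbad := by
    have h1 := farNu_eq_one.1 hab
    have h2 := H.fine_pos σ hσ a ha a' ha'
    have h3 := H.fine_pos τ hτ b' hb' b hb
    rw [hbad, H.pos_T] at h3
    simp only [H.pos_T] at h1
    have h4 := dist_triangle (pos a) (pos a') (-pos b)
    have h5 : dist (pos a') (-pos b) = dist (-pos a') (pos b) := by
      rw [← dist_neg_neg, neg_neg]
    linarith
  nu_diag z := farNu_eq_zero.2 (by simpa using he)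
  nu_anti σ hσ z hz := farNu_eq_one.2 (by
    have h3 := H.norm_pos hK hσ hz
    simp only [H.pos_T]
    rw [dist_eq_norm, sub_neg_eq_add, ← two_smul ℝ, norm_smul]
    norm_num
    linarith)
  inv := H.inv
  cyc := H.cyc
  odd := H.odd

end Sys

end Metric

/-! ### The doubling step -/

section Half

variable {Z ι : Type*} [LinearOrder ι]

/-- The representative of an unordered pair whose first entry is smaller. -/
def ordPair (mu : Z → ι) (p : Z × Z) : Z × Z := if mu p.1 ≤ mu p.2 then p else p.swap

/-- Comparison of a coordinate of `h` at the two entries of a pair. -/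
noncomputable def cmpH {N : ℕ} (mu : Z → ι) (h : Z → Fin N → ℝ) (j : Fin N) (p : Z × Z) : ZMod 2 :=
  if h p.1 j < h p.2 j then 0 else if h p.2 j < h p.1 j then 1 else ordM mu p

/-- The comparisons of all coordinates. -/
noncomputable def cmps {N : ℕ} (mu : Z → ι) (h : Z → Fin N → ℝ) : List (Z × Z → ZMod 2) :=
  (List.finRange N).map (cmpH mu h)

/-- The cycle of midpoints of pairs of almost equal value at a fixed distance. -/
noncomputable def midChain {N : ℕ} (mu : Z → ι) (nu : Z × Z → ZMod 2) (h : Z → Fin N → ℝ)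
    (c : List (List Z)) : List (List (Z × Z)) :=
  (caps (cmps mu h) (sel (fun p => ordM mu p + 1) (cap nu (square c)))).map
    (List.map (ordPair mu))

variable {N : ℕ} {T : Z → Z} {lam : Z → ZMod 2} {mu : Z → ι} {nu : Z × Z → ZMod 2}
  {h : Z → Fin N → ℝ} {c : List (List Z)} {D : ℕ}

lemma pr_midChain (w : List (Z × Z) → ZMod 2) : pr (midChain mu nu h c) w =
    jump nu c (cut (fun p => ordM mu p + 1) (cups (cmps mu h)
      fun l => w (l.map (ordPair mu)))) := by
  rw [midChain, pr_map, pr_caps, pr_sel, pr_cap, pr_square]; rfl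

lemma signL_ordPair (p : Z × Z) : lam (ordPair mu p).1 = signL mu lam p := by
  unfold ordPair signL; split_ifs <;> rfl

lemma mem_midChain {s : List (Z × Z)} (hs : s ∈ midChain mu nu h c) :
    ∃ σ ∈ c, ∃ τ ∈ c, ∃ t ∈ sh σ τ, ∃ l, l <:+ t ∧ s = l.map (ordPair mu) ∧
      (∃ p ∈ t, ∃ q ∈ t, nu p ≠ nu q) ∧ ∀ j, ∃ p ∈ t, ∃ q ∈ t, cmpH mu h j p ≠ cmpH mu h j q := by
  obtain ⟨l, hl, rfl⟩ := List.mem_map.1 hs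
  obtain ⟨s1, hs1, h1, h2⟩ := mem_caps hl
  obtain ⟨t, ht, h3, h4⟩ := mem_cap (mem_of_mem_sel hs1)
  obtain ⟨σ, hσ, τ, hτ, h5⟩ := mem_square ht
  refine ⟨σ, hσ, τ, hτ, t, h5, l, h1.trans h3, rfl, h4, fun j => ?_⟩
  obtain ⟨p, hp, q, hq, e⟩ := h2 (cmpH mu h j) (by simp [cmps])
  exact ⟨p, h3.subset hp, q, h3.subset hq, e⟩

namespace Doubling

variable (H : Doubling T lam mu nu c D)
include H

lemma ordPair_T (p : Z × Z) : ordPair mu (Prod.map T T p) = Prod.map T T (ordPair mu p) := by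
  simp only [ordPair, Prod.map_fst, Prod.map_snd, H.mu_T]
  split_ifs <;> rfl

lemma ordPair_swap {p : Z × Z} (hp : OffDiag T p) : ordPair mu p.swap = ordPair mu p := by
  rcases lt_or_gt_of_ne (H.mu_ne hp) with h | h
  · simp [ordPair, h.le, h.not_ge]
  · simp [ordPair, h.le, h.not_ge]

lemma cmpH_T (hT : ∀ z, h (T z) = h z) (j : Fin N) (p : Z × Z) :
    cmpH mu h j (Prod.map T T p) = cmpH mu h j p := by
  simp only [cmpH, Prod.map_fst, Prod.map_snd, hT, H.ordM_T]

lemma cmpH_swap (j : Fin N) {p : Z × Z} (hp : OffDiag T p) :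
    cmpH mu h j p.swap = cmpH mu h j p + 1 := by
  have := H.labels.M_swap p hp
  simp only [cmpH, Prod.fst_swap, Prod.snd_swap]
  rcases lt_trichotomy (h p.1 j) (h p.2 j) with e | e | e
  · simp [e, e.le]
  · simp [e, this]
  · simp only [e, e.not_gt, if_true, if_false]; exact (two_zero 1).symm

lemma midChain_inv (hT : ∀ z, h (T z) = h z) (w : List (Z × Z) → ZMod 2) :
    pr (midChain mu nu h c) (fun l => w (l.map (Prod.map T T))) = pr (midChain mu nu h c) w := by
  have h1 : (cmps mu h).map (fun x a => x (Prod.map T T a)) = cmps mu h := by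
    rw [cmps, List.map_map]
    exact List.map_congr_left fun j _ => funext fun p => H.cmpH_T hT j p
  have h2 : ordPair mu ∘ Prod.map T T = Prod.map T T ∘ ordPair mu := funext H.ordPair_T
  rw [pr_midChain, pr_midChain]
  refine Eq.trans ?_ (H.invCycle.trans _)
  congr 1
  funext l
  rw [cut_map]
  simp only [cups_map, H.ordM_T, h1, List.map_map, h2]

lemma midChain_cyc {w : List (Z × Z) → ZMod 2} (hw : w [] = 0) :
    pr (midChain mu nu h c) (d w) = 0 := by
  set v : List (Z × Z) → ZMod 2 := fun l => w (l.map (ordPair mu)) with hv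
  have h0 : v [] = 0 := hw
  have h1 : (fun l : List (Z × Z) => d w (l.map (ordPair mu))) = d v :=
    funext fun l => (d_comp_map _ w l).symm
  have h2 : InvOn (OffDiag T) Prod.swap v := by
    intro l _ hl
    simp only [hv, List.map_map]
    congr 1
    exact List.map_congr_left fun p hp => H.ordPair_swap (hl p hp)
  have h3 : InvOn (OffDiag T) Prod.swap (cup (fun p => ordM mu p + 1) (cups (cmps mu h) v)) := by
    refine (h2.cups fun x hx => ?_).cup ⟨1, fun p hp => by simp only [H.labels.M_swap p hp]⟩
    obtain ⟨j, -, rfl⟩ := List.mem_map.1 hx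
    exact ⟨1, fun p hp => H.cmpH_swap j hp⟩
  have h4 := H.invCycle.bdry (cut (fun p => ordM mu p + 1) (cups (cmps mu h) v)) rfl
  rw [funext (d_cut _ (cups_apply_nil _ h0)), H.invCycle.add, H.labels.kill_swap H.invCycle h3,
    zero_add, d_cups h0] at h4
  rw [pr_midChain, h1, h4]

lemma midChain_odd (hT : ∀ z, h (T z) = h z) {D' : ℕ} (hD : N + 1 + D' = 2 * D)
    (hD' : D ≤ N + 1) :
    pr (midChain mu nu h c) (cut (fun z => lam z.1 + 1)
      (cups (List.replicate D' fun z => lam z.1) one)) = (((N + 1).choose (D - D') : ℕ) : ZMod 2) := by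
  rw [pr_midChain, ← H.jump_eval hD hD' (cmps mu h) (by simp [cmps])]
  · congr 3
    funext l
    rw [cut_map]
    simp only [cups_map, signL_ordPair, one_map, List.map_replicate]
  · intro r hr p hp
    obtain ⟨j, -, rfl⟩ := List.mem_map.1 hr
    exact H.cmpH_swap j hp
  · intro r hr p hp
    obtain ⟨j, -, rfl⟩ := List.mem_map.1 hr
    exact H.cmpH_T hT j p

end Doubling
end Half

section Step

variable {E : Type*} [NormedAddCommGroup E] [NormedSpace ℝ E] {N : ℕ}
  {F : Metric.sphere (0 : E) 1 → Fin N → ℝ} {D K : ℕ} {om rho eta : ℝ} {Z : Type}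
  {T : Z → Z} {lam : Z → ZMod 2} {rk : Z → ℕ} {pos : Z → E} {h : Z → Fin N → ℝ}
  {c : List (List Z)}

lemma midpoint_ordPair {ι V : Type*} [LinearOrder ι] [AddCommGroup V] [Module ℝ V] (mu : Z → ι)
    (g : Z → V) (p : Z × Z) : midpoint ℝ (g (ordPair mu p).1) (g (ordPair mu p).2) =
      midpoint ℝ (g p.1) (g p.2) := by
  unfold ordPair
  split_ifs
  · rfl
  · exact midpoint_comm ..

lemma le_of_cmpH_ne {ι : Type*} [LinearOrder ι] {mu : Z → ι} {j : Fin N} {p q : Z × Z}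
    (hpq : cmpH mu h j p ≠ cmpH mu h j q) :
    (h p.1 j ≤ h p.2 j ∨ h q.1 j ≤ h q.2 j) ∧ (h p.2 j ≤ h p.1 j ∨ h q.2 j ≤ h q.1 j) := by
  constructor <;> by_contra! hc <;> refine hpq ?_
  · simp [cmpH, hc.1, hc.2, hc.1.not_gt, hc.2.not_gt]
  · simp [cmpH, hc.1, hc.2]

lemma midChain_fine {ι : Type*} [LinearOrder ι] {mu : Z → ι} {nu : Z × Z → ZMod 2}
    {V : Type*} [SeminormedAddCommGroup V] [NormedSpace ℝ V] {g : Z → V} {r : ℝ}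
    (hg : ∀ σ ∈ c, ∀ a ∈ σ, ∀ b ∈ σ, dist (g a) (g b) ≤ r) {s : List (Z × Z)}
    (hs : s ∈ midChain mu nu h c) {y z : Z × Z} (hy : y ∈ s) (hz : z ∈ s) :
    dist (midpoint ℝ (g y.1) (g y.2)) (midpoint ℝ (g z.1) (g z.2)) ≤ r := by
  obtain ⟨σ, hσ, τ, hτ, t, ht, l, hl, rfl, -⟩ := mem_midChain hs
  obtain ⟨p, hp, rfl⟩ := List.mem_map.1 hy
  obtain ⟨q, hq, rfl⟩ := List.mem_map.1 hz
  have hp := mem_of_mem_sh ht p (hl.subset hp)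
  have hq := mem_of_mem_sh ht q (hl.subset hq)
  rw [midpoint_ordPair, midpoint_ordPair]
  have h1 := dist_midpoint_midpoint_le (g p.1) (g p.2) (g q.1) (g q.2)
  have h2 := hg σ hσ _ hp.1 _ hq.1
  have h3 := hg τ hτ _ hp.2 _ hq.2
  linarith

namespace Sys

variable (H : Sys F D K om rho eta T lam rk pos h c)
include H

omit [NormedSpace ℝ E] in
lemma abs_sub_le_of_cmpH {ι : Type*} [LinearOrder ι] {mu : Z → ι} {σ τ : List Z} (hσ : σ ∈ c)
    (hτ : τ ∈ c) {j : Fin N} {p q r : Z × Z} (hp : p.1 ∈ σ ∧ p.2 ∈ τ) (hq : q.1 ∈ σ ∧ q.2 ∈ τ)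
    (hr : r.1 ∈ σ ∧ r.2 ∈ τ) (hpq : cmpH mu h j p ≠ cmpH mu h j q) :
    |h r.1 j - h r.2 j| ≤ 2 * eta := by
  have key : ∀ σ ∈ c, ∀ a ∈ σ, ∀ b ∈ σ, |h a j - h b j| ≤ eta := fun σ hσ a ha b hb => by
    rw [← Real.dist_eq]
    exact (dist_le_pi_dist _ _ _).trans (H.fine_h σ hσ a ha b hb)
  have h1 := abs_le.1 (key σ hσ _ hr.1 _ hp.1)
  have h2 := abs_le.1 (key σ hσ _ hr.1 _ hq.1)
  have h3 := abs_le.1 (key τ hτ _ hr.2 _ hp.2)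
  have h4 := abs_le.1 (key τ hτ _ hr.2 _ hq.2)
  obtain ⟨h5, h6⟩ := le_of_cmpH_ne hpq
  rw [abs_le]
  constructor
  · rcases h6 with h6 | h6 <;> linarith
  · rcases h5 with h5 | h5 <;> linarith

omit [NormedSpace ℝ E] in
lemma midChain_data {ι : Type*} [LinearOrder ι] {mu : Z → ι} {e : ℝ} {s : List (Z × Z)}
    (hs : s ∈ midChain mu (farNu pos e) h c) {z : Z × Z} (hz : z ∈ s) :
    (∃ σ ∈ c, z.1 ∈ σ) ∧ (∃ σ ∈ c, z.2 ∈ σ) ∧ e - 2 * eta ≤ dist (pos z.1) (pos z.2) ∧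
      dist (pos z.1) (pos z.2) ≤ e + 2 * eta ∧ ∀ j, |h z.1 j - h z.2 j| ≤ 2 * eta := by
  obtain ⟨σ, hσ, τ, hτ, t, ht, l, hl, rfl, ⟨p, hp, q, hq, hpq⟩, hj⟩ := mem_midChain hs
  obtain ⟨r, hr, rfl⟩ := List.mem_map.1 hz
  have hr := mem_of_mem_sh ht r (hl.subset hr)
  have hd : e - 2 * eta ≤ dist (pos r.1) (pos r.2) ∧ dist (pos r.1) (pos r.2) ≤ e + 2 * eta := by
    have key : ∀ p ∈ t, ∀ q ∈ t, farNu pos e p = 0 → farNu pos e q ≠ 0 →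
        e - 2 * eta ≤ dist (pos r.1) (pos r.2) ∧ dist (pos r.1) (pos r.2) ≤ e + 2 * eta := by
      intro p hp q hq h1 h2
      have hp := mem_of_mem_sh ht p hp
      have hq := mem_of_mem_sh ht q hq
      rw [farNu_eq_zero] at h1
      rw [Ne, farNu_eq_zero, not_lt] at h2
      have h3 := H.dist_close hσ hτ hr.1 hp.1 hr.2 hp.2
      have h4 := H.dist_close hσ hτ hq.1 hr.1 hq.2 hr.2
      constructor <;> linarith
    by_cases h0 : farNu pos e p = 0
    · exact key p hp q hq h0 fun h1 => hpq (h0.trans h1.symm)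
    · refine key q hq p hp ?_ h0
      by_contra h1
      refine hpq ?_
      generalize farNu pos e p = x at *
      generalize farNu pos e q = y at *
      revert h0 h1; clear hpq; revert x y; decide
  have hh : ∀ j, |h r.1 j - h r.2 j| ≤ 2 * eta := fun j => by
    obtain ⟨p, hp, q, hq, e⟩ := hj j
    exact H.abs_sub_le_of_cmpH hσ hτ (mem_of_mem_sh ht p hp) (mem_of_mem_sh ht q hq) hr e
  unfold ordPair
  split_ifs
  · exact ⟨⟨σ, hσ, hr.1⟩, ⟨τ, hτ, hr.2⟩, hd.1, hd.2, hh⟩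
  · simp only [Prod.fst_swap, Prod.snd_swap, dist_comm (pos r.2), abs_sub_comm (h r.2 _)]
    exact ⟨⟨τ, hτ, hr.2⟩, ⟨σ, hσ, hr.1⟩, hd.1, hd.2, hh⟩

omit [NormedSpace ℝ E] in
lemma midChain_sorted {ι : Type*} [LinearOrder ι] {mu : Z → ι} {nu : Z × Z → ZMod 2}
    {s : List (Z × Z)} (hs : s ∈ midChain mu nu h c) :
    s.Pairwise fun y z => rk y.1 + rk y.2 < rk z.1 + rk z.2 := by
  obtain ⟨σ, hσ, τ, hτ, t, ht, l, hl, rfl, -⟩ := mem_midChain hs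
  have h1 := (pairwise_of_mem_sh ht rk rk (H.sorted σ hσ) (H.sorted τ hτ)).sublist hl.sublist
  have key : ∀ p : Z × Z, rk (ordPair mu p).1 + rk (ordPair mu p).2 = rk p.1 + rk p.2 := fun p => by
    unfold ordPair
    split_ifs
    · rfl
    · exact add_comm _ _
  simpa only [List.pairwise_map, key] using h1

lemma leaf_pair (he : 0 < eta) {e : ℝ} (hom : om = e / 8) (heta : eta ≤ e / 16) {z : Z × Z}
    (h1 : ∃ σ ∈ c, z.1 ∈ σ) (h2 : ∃ σ ∈ c, z.2 ∈ σ)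
    (h3 : e - 2 * eta ≤ dist (pos z.1) (pos z.2)) (h4 : dist (pos z.1) (pos z.2) ≤ e + 2 * eta)
    (h5 : ∀ j, |h z.1 j - h z.2 j| ≤ 2 * eta) :
    ∃ x : Fin (2 * K) → Metric.sphere (0 : E) 1,
      (∀ i, dist (x i : E) (midpoint ℝ (pos z.1) (pos z.2)) ≤ e) ∧
      (∀ i, dist (F (x i)) (midpoint ℝ (h z.1) (h z.2)) ≤ 2 * eta) ∧
      ∀ i j, i ≠ j → min rho (e / 2) ≤ dist (x i) (x j) := by
  obtain ⟨σ, hσ, h1⟩ := h1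
  obtain ⟨τ, hτ, h2⟩ := h2
  obtain ⟨x, x1, x2, x3⟩ := H.leaf σ hσ _ h1
  obtain ⟨y, y1, y2, y3⟩ := H.leaf τ hτ _ h2
  have h5' : dist (h z.1) (h z.2) ≤ 2 * eta :=
    (dist_pi_le_iff (by linarith)).2 fun j => by rw [Real.dist_eq]; exact h5 j
  have m1 := dist_left_midpoint (𝕜 := ℝ) (pos z.1) (pos z.2)
  have m2 := dist_right_midpoint (𝕜 := ℝ) (pos z.1) (pos z.2)
  have m3 := dist_left_midpoint (𝕜 := ℝ) (h z.1) (h z.2)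
  have m4 := dist_right_midpoint (𝕜 := ℝ) (h z.1) (h z.2)
  rw [Real.norm_two] at m1 m2 m3 m4
  have hxy : ∀ i j, e / 2 ≤ dist (x i) (y j) := fun i j => by
    have t := dist_triangle4 (pos z.1) (x i : E) (y j : E) (pos z.2)
    have a := x1 i
    have b := y1 j
    rw [dist_comm] at a
    rw [Subtype.dist_eq]
    linarith
  let g : Fin 2 × Fin K → Metric.sphere (0 : E) 1 := fun p => if p.1 = 0 then x p.2 else y p.2
  refine ⟨fun i => g (finProdFinEquiv.symm i), fun i => ?_, fun i => ?_, fun i j hij => ?_⟩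
  · suffices ∀ p, dist (g p : E) (midpoint ℝ (pos z.1) (pos z.2)) ≤ e from this _
    intro p
    simp only [g]
    split_ifs
    · have t := dist_triangle (x p.2 : E) (pos z.1) (midpoint ℝ (pos z.1) (pos z.2))
      have a := x1 p.2
      linarith
    · have t := dist_triangle (y p.2 : E) (pos z.2) (midpoint ℝ (pos z.1) (pos z.2))
      have a := y1 p.2
      linarith
  · suffices ∀ p, dist (F (g p)) (midpoint ℝ (h z.1) (h z.2)) ≤ 2 * eta from this _
    intro p
    simp only [g]
    split_ifs
    · have t := dist_triangle (F (x p.2)) (h z.1) (midpoint ℝ (h z.1) (h z.2))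
      have a := x2 p.2
      linarith
    · have t := dist_triangle (F (y p.2)) (h z.2) (midpoint ℝ (h z.1) (h z.2))
      have a := y2 p.2
      linarith
  · suffices ∀ p q, p ≠ q → min rho (e / 2) ≤ dist (g p) (g q) from
      this _ _ (finProdFinEquiv.symm.injective.ne hij)
    rintro ⟨p, p'⟩ ⟨q, q'⟩ hpq
    simp only [g]
    split_ifs with hp hq hq
    · exact min_le_of_left_le (x3 _ _ fun e => hpq (Prod.ext (hp.trans hq.symm) e))
    · exact min_le_of_right_le (hxy _ _)
    · rw [dist_comm]; exact min_le_of_right_le (hxy _ _)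
    · exact min_le_of_left_le (y3 _ _ fun e => hpq (Prod.ext (by simp only; omega) e))

end Sys

/-- Midpoints of pairs in a symmetric cycle form a symmetric cycle with twice as many points. -/
theorem HasSys.double (hS : HasSys F D K) (hK : 0 < K) {D' l : ℕ} (hD : N + 1 + D' = 2 * D)
    (hD' : D ≤ N + 1) (hl : N + 1 = 2 ^ l - 1) : HasSys F D' (2 * K) := by
  intro om hom
  set e := min om (1 / 2) with he
  have he0 : 0 < e := by positivity
  obtain ⟨rho, hrho, hS⟩ := hS (e / 8) (by positivity)
  refine ⟨min rho (e / 2), by positivity, fun eta heta => ?_⟩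
  set eta0 := min (e / 16) (eta / 2) with heta0
  have h1 : eta0 ≤ e / 16 := min_le_left _ _
  have h2 : eta0 ≤ eta / 2 := min_le_right _ _
  have h3 : 0 < eta0 := by positivity
  obtain ⟨Z, T, lam, rk, pos, h, c, H⟩ := hS eta0 h3
  classical
  let _ : LinearOrder Z := linearOrderOfSTO WellOrderingRel
  have HD := H.doubling hK he0 (min_le_right _ _) le_rfl h1
  refine ⟨Z × Z, Prod.map T T, fun z => lam z.1, fun z => rk z.1 + rk z.2,
    fun z => midpoint ℝ (pos z.1) (pos z.2), fun z => midpoint ℝ (h z.1) (h z.2),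
    midChain (ordMu T rk) (farNu pos e) h c, ?_⟩
  constructor
  · rintro ⟨y, z⟩; simp [H.T_T]
  · intro z; exact H.lam_T z.1
  · intro z; simp [H.rk_T]
  · intro z
    simp only [Prod.map_fst, Prod.map_snd, H.pos_T, midpoint_eq_smul_add]
    rw [← neg_add, smul_neg]
  · intro z; simp [H.h_T]
  · intro s hs; exact H.midChain_sorted hs
  · intro s hs y hy z hz
    exact (midChain_fine H.fine_pos hs hy hz).trans (by linarith)
  · intro s hs y hy z hz
    exact (midChain_fine H.fine_h hs hy hz).trans (by linarith)
  · exact HD.midChain_inv H.h_T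
  · intro w hw; exact HD.midChain_cyc hw
  · rw [HD.midChain_odd H.h_T hD hD', hl, choose_two_pow_sub_one _ _ (by omega)]
  · intro s hs z hz
    obtain ⟨a1, a2, a3, a4, a5⟩ := H.midChain_data hs hz
    obtain ⟨x, x1, x2, x3⟩ := H.leaf_pair h3 rfl h1 a1 a2 a3 a4 a5
    exact ⟨x, fun i => (x1 i).trans (min_le_left _ _), fun i => (x2 i).trans (by linarith), x3⟩

end Step

/-! ### The cubical sphere -/

section Grid

/-- The edge from `k` to `k + 1`, starting at its even end. -/
def edge (k : ℕ) : List ℤ := if k % 2 = 0 then [(k : ℤ), (k : ℤ) + 1] else [(k : ℤ) + 1, (k : ℤ)]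

/-- The edges of the interval from `-m` to `m`. -/
def edges : ℕ → List (List ℤ)
  | 0 => []
  | m + 1 => edge m :: (edge m).map Neg.neg :: edges m

/-- The staircase triangulation of the cube with side from `-m` to `m`. -/
def grid (m : ℕ) : (j : ℕ) → List (List (Fin j → ℤ))
  | 0 => [[0]]
  | j + 1 => ((edges m).flatMap fun e => (grid m j).flatMap (sh e)).map
      (List.map fun p => Fin.cons p.1 p.2)

/-- Points on the boundary of the cube or outside. -/
def Outer (m : ℕ) {j : ℕ} (x : Fin j → ℤ) : Prop := ∃ i, m ≤ (x i).natAbs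

/-- The sign of the first nonzero coordinate. -/
def sgn : {j : ℕ} → (Fin j → ℤ) → ZMod 2
  | 0, _ => 0
  | _ + 1, x => if x 0 = 0 then sgn (Fin.tail x) else if 0 < x 0 then 0 else 1

lemma edge_ne_nil (k : ℕ) : edge k ≠ [] := by
  unfold edge; split_ifs <;> simp

lemma mem_edges {m : ℕ} {e : List ℤ} (he : e ∈ edges m) :
    ∃ k < m, e = edge k ∨ e = (edge k).map Neg.neg := by
  induction m with
  | zero => simp [edges] at he
  | succ m ih =>
    rcases List.mem_cons.1 he with rfl | he
    · exact ⟨m, by omega, Or.inl rfl⟩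
    rcases List.mem_cons.1 he with rfl | he
    · exact ⟨m, by omega, Or.inr rfl⟩
    obtain ⟨k, hk, h⟩ := ih he
    exact ⟨k, by omega, h⟩

lemma pr_edges_neg (m : ℕ) (w : List ℤ → ZMod 2) :
    pr (edges m) (fun l => w (l.map Neg.neg)) = pr (edges m) w := by
  induction m with
  | zero => rfl
  | succ m ih =>
    simp only [pr, edges, List.map_cons, List.sum_cons, List.map_map] at ih ⊢
    rw [ih]
    have : (Neg.neg ∘ Neg.neg : ℤ → ℤ) = id := funext neg_neg
    rw [this, List.map_id]
    ring

lemma pr_edges_d (m : ℕ) (w : List ℤ → ZMod 2) :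
    pr (edges m) (d w) = w [(m : ℤ)] + w [-(m : ℤ)] := by
  induction m with
  | zero => simp [edges, pr, two_zero]
  | succ m ih =>
    simp only [pr, edges, List.map_cons, List.sum_cons] at ih ⊢
    rw [ih]
    have h1 := two_zero (w [(m : ℤ)])
    have h2 := two_zero (w [-(m : ℤ)])
    unfold edge
    split_ifs <;> simp [d_cons, neg_add_rev, add_comm (-1 : ℤ)] <;> grind

lemma pr_edges_eq {m : ℕ} (hm : 0 < m) {w : List ℤ → ZMod 2}
    (hw : ∀ k, 0 < k → w (edge k) = 0 ∧ w ((edge k).map Neg.neg) = 0) :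
    pr (edges m) w = w [0, 1] + w [0, -1] := by
  induction m, hm using Nat.le_induction with
  | base => simp [pr, edges, edge]
  | succ m hm ih =>
    simp only [pr, edges, List.map_cons, List.sum_cons] at ih ⊢
    rw [ih, (hw m hm).1, (hw m hm).2]
    simp

lemma edges_sorted {m : ℕ} {e : List ℤ} (he : e ∈ edges m) :
    e.Pairwise fun a b => a.natAbs % 2 < b.natAbs % 2 := by
  obtain ⟨k, -, rfl | rfl⟩ := mem_edges he <;> unfold edge <;> split_ifs <;> simp <;> omega

lemma edges_close {m : ℕ} {e : List ℤ} (he : e ∈ edges m) {a b : ℤ} (ha : a ∈ e) (hb : b ∈ e) :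
    |a - b| ≤ 1 := by
  obtain ⟨k, -, rfl | rfl⟩ := mem_edges he <;> unfold edge at ha hb <;> split_ifs at ha hb <;>
    simp at ha hb <;> rw [abs_le] <;> omega

lemma pr_grid (m j : ℕ) (w : List (Fin (j + 1) → ℤ) → ZMod 2) :
    pr (grid m (j + 1)) w = pr (edges m) fun e => pr (grid m j) fun σ =>
      X (fun s => w (s.map fun p => Fin.cons p.1 p.2)) e σ := by
  rw [grid, pr_map, pr_flatMap]
  congr 1
  funext e
  rw [pr_flatMap]
  rfl

lemma mem_grid {m j : ℕ} {s : List (Fin (j + 1) → ℤ)} (hs : s ∈ grid m (j + 1)) :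
    ∃ e ∈ edges m, ∃ σ ∈ grid m j, ∃ t ∈ sh e σ, s = t.map fun p => Fin.cons p.1 p.2 := by
  obtain ⟨t, ht, rfl⟩ := List.mem_map.1 hs
  obtain ⟨e, he, ht⟩ := List.mem_flatMap.1 ht
  obtain ⟨σ, hσ, ht⟩ := List.mem_flatMap.1 ht
  exact ⟨e, he, σ, hσ, t, ht, rfl⟩

lemma grid_close {m j : ℕ} {s : List (Fin j → ℤ)} (hs : s ∈ grid m j) {x y : Fin j → ℤ}
    (hx : x ∈ s) (hy : y ∈ s) (i : Fin j) : |x i - y i| ≤ 1 := by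
  induction j with
  | zero => exact i.elim0
  | succ j ih =>
    obtain ⟨e, he, σ, hσ, t, ht, rfl⟩ := mem_grid hs
    obtain ⟨p, hp, rfl⟩ := List.mem_map.1 hx
    obtain ⟨q, hq, rfl⟩ := List.mem_map.1 hy
    have hp := mem_of_mem_sh ht p hp
    have hq := mem_of_mem_sh ht q hq
    refine Fin.cases ?_ (fun i => ?_) i
    · exact edges_close he hp.1 hq.1
    · exact ih hσ hp.2 hq.2 i

lemma grid_sorted {m j : ℕ} {s : List (Fin j → ℤ)} (hs : s ∈ grid m j) :
    s.Pairwise fun x y => ∑ i, (x i).natAbs % 2 < ∑ i, (y i).natAbs % 2 := by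
  induction j with
  | zero =>
    simp only [grid, List.mem_singleton] at hs
    simp [hs]
  | succ j ih =>
    obtain ⟨e, he, σ, hσ, t, ht, rfl⟩ := mem_grid hs
    have := pairwise_of_mem_sh ht (fun a => a.natAbs % 2) (fun x => ∑ i, (x i).natAbs % 2)
      (edges_sorted he) (ih hσ)
    rw [List.pairwise_map]
    simpa [Fin.sum_univ_succ] using this

lemma pr_grid_neg (m j : ℕ) (w : List (Fin j → ℤ) → ZMod 2) :
    pr (grid m j) (fun l => w (l.map Neg.neg)) = pr (grid m j) w := by
  induction j with
  | zero => simp [grid, pr]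
  | succ j ih =>
    rw [pr_grid, pr_grid]
    set v : List (ℤ × (Fin j → ℤ)) → ZMod 2 := fun s => w (s.map fun p => Fin.cons p.1 p.2) with hv
    have h1 : (fun s : List (ℤ × (Fin j → ℤ)) =>
        w ((s.map fun p => (Fin.cons p.1 p.2 : Fin (j + 1) → ℤ)).map Neg.neg)) =
        fun s => v (s.map (Prod.map Neg.neg Neg.neg)) := by
      funext s
      simp only [hv, List.map_map]
      congr 2
      funext p
      refine funext fun i => ?_
      refine Fin.cases ?_ (fun i => ?_) i <;> simp
    rw [h1]
    simp only [X_map]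
    rw [pr_edges_neg m fun e => pr (grid m j) fun σ => X v e (σ.map Neg.neg)]
    exact pr_congr fun e _ => ih (X v e)

lemma pr_grid_d (m j : ℕ) {v : List (Fin j → ℤ) → ZMod 2} (h0 : v [] = 0)
    (hv : ∀ l : List (Fin j → ℤ), (∀ x ∈ l, Outer m x) → v l = 0) : pr (grid m j) (d v) = 0 := by
  induction j with
  | zero => simp [grid, pr, d_cons, h0]
  | succ j ih =>
    rw [pr_grid]
    set u : List (ℤ × (Fin j → ℤ)) → ZMod 2 := fun s => v (s.map fun p => Fin.cons p.1 p.2) with hu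
    have u0 : u [] = 0 := h0
    have h1 : (fun s : List (ℤ × (Fin j → ℤ)) => d v (s.map fun p => Fin.cons p.1 p.2)) = d u :=
      funext fun s => (d_comp_map _ v s).symm
    have h2 : ∀ {e : List ℤ} {σ : List (Fin j → ℤ)},
        (∀ a ∈ e, ∀ x ∈ σ, Outer m (Fin.cons a x : Fin (j + 1) → ℤ)) → X u e σ = 0 := by
      intro e σ h
      have : X u e σ = X (fun _ => 0) e σ := X_congr fun s hs => hv _ fun x hx => by
        obtain ⟨p, hp, rfl⟩ := List.mem_map.1 hx
        have := mem_of_mem_sh hs p hp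
        exact h _ this.1 _ this.2
      rw [this]
      simp [X]
    have h3 : ∀ e, pr (grid m j) (d fun t => X u e t) = 0 := fun e => by
      refine ih (by simp) fun l hl => h2 fun a _ x hx => ?_
      obtain ⟨i, hi⟩ := hl x hx
      exact ⟨i.succ, by simpa using hi⟩
    have h4 : ∀ σ, pr (edges m) (d fun s => X u s σ) = 0 := fun σ => by
      rw [pr_edges_d, h2, h2, add_zero]
      · intro a ha x _
        exact ⟨0, by simp at ha; simp [ha]⟩
      · intro a ha x _
        exact ⟨0, by simp at ha; simp [ha]⟩
    simp only [h1, X_d u0, pr_add, h3, add_zero]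
    rw [pr_comm]
    simp only [h4, pr_zero]

lemma X_cup_eq_zero {α β : Type*} {x : α × β → ZMod 2} {w : List (α × β) → ZMod 2} {σ : List α}
    {τ : List β} (b : ZMod 2) (hx : ∀ p ∈ σ, ∀ q ∈ τ, x (p, q) = b) : X (cup x w) σ τ = 0 := by
  have : X (cup x w) σ τ = X (fun _ => 0) σ τ := X_congr fun s hs => by
    have h := mem_of_mem_sh hs
    rcases s with _ | ⟨p, _ | ⟨q, s⟩⟩
    · rfl
    · rfl
    · have hp := h p (by simp)
      have hq := h q (by simp)
      rw [cup_cons, hx p.1 hp.1 p.2 hp.2, hx q.1 hq.1 q.2 hq.2, two_zero, zero_mul]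
  rw [this]
  simp [X]

lemma X_cups_edge {β : Type*} {a b : ℤ} {x : ℤ × β → ZMod 2} (t : β → ZMod 2) (e : ZMod 2)
    (ha : ∀ y, x (a, y) = t y) (hb : ∀ y, x (b, y) = e) (j : ℕ) (y : β) (ys : List β) :
    X (cups (List.replicate (j + 1) x) one) [a, b] (y :: ys) =
      (e + t ((y :: ys).getLast (by simp))) * cups (List.replicate j t) one (y :: ys) := by
  induction j generalizing y ys with
  | zero =>
    simp only [zero_add, List.replicate_one, List.replicate_zero, cups_cons, cups_nil]
    rw [X_cup]
    rcases ys with _ | ⟨y', ys⟩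
    · simp [X_cons, bothNil, ha, hb, add_comm]
    · have h1 : X one [b] (y :: y' :: ys) = 0 := by
        have : X one [b] (y :: y' :: ys) = X (fun _ => 0) [b] (y :: y' :: ys) :=
          X_congr fun s hs => by
            have := length_of_mem_sh hs
            rcases s with _ | ⟨p, _ | ⟨q, s⟩⟩ <;> simp at this ⊢
            omega
        rw [this]; simp [X]
      have h2 : X one [a, b] (y' :: ys) = 0 := by
        have : X one [a, b] (y' :: ys) = X (fun _ => 0) [a, b] (y' :: ys) :=
          X_congr fun s hs => by
            have := length_of_mem_sh hs
            rcases s with _ | ⟨p, _ | ⟨q, s⟩⟩ <;> simp at this ⊢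
        rw [this]; simp [X]
      simp [h1, h2]
  | succ j ih =>
    rw [List.replicate_succ, cups_cons, X_cup, List.replicate_succ, cups_cons,
      X_cup_eq_zero e (by simp [hb]), mul_zero, zero_add, ← cups_cons, ← List.replicate_succ]
    rcases ys with _ | ⟨y', ys⟩
    · simp [List.replicate_succ]
    · rw [ih, List.replicate_succ, cups_cons, cup_cons]
      simp [ha]
      ring

lemma sgn_cons_zero {j : ℕ} (x : Fin j → ℤ) : sgn (Fin.cons 0 x : Fin (j + 1) → ℤ) = sgn x := by
  simp [sgn]

lemma sgn_cons {j : ℕ} {a : ℤ} (ha : a ≠ 0) (x : Fin j → ℤ) :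
    sgn (Fin.cons a x : Fin (j + 1) → ℤ) = if 0 < a then 0 else 1 := by
  simp [sgn, ha]

lemma sgn_neg {j : ℕ} {x : Fin j → ℤ} (hx : x ≠ 0) : sgn (-x) = sgn x + 1 := by
  induction j with
  | zero => exact absurd (Subsingleton.elim _ _) hx
  | succ j ih =>
    simp only [sgn, Pi.neg_apply, neg_eq_zero]
    split_ifs with h1 h2 h3 h3
    · refine ih fun h => hx (funext fun i => Fin.cases h1 (fun i => ?_) i)
      exact congrFun h i
    · omega
    · exact (two_zero 1).symm
    · simp
    · omega

open Classical in
/-- The indicator of the boundary and the exterior of the cube. -/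
noncomputable def outInd (m : ℕ) {j : ℕ} (x : Fin j → ℤ) : ZMod 2 := if Outer m x then 1 else 0

lemma outInd_cons {m j : ℕ} (hm : 0 < m) (x : Fin j → ℤ) :
    outInd m (Fin.cons 0 x : Fin (j + 1) → ℤ) = outInd m x := by
  have : Outer m (Fin.cons 0 x : Fin (j + 1) → ℤ) ↔ Outer m x := by
    simp only [Outer, Fin.exists_fin_succ, Fin.cons_zero, Fin.cons_succ, Int.natAbs_zero]
    constructor
    · rintro (h | h)
      · omega
      · exact h
    · exact Or.inr
  by_cases h : Outer m x
  · rw [outInd, outInd, if_pos h, if_pos (this.2 h)]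
  · rw [outInd, outInd, if_neg h, if_neg (h ∘ this.1)]

lemma grid_ne_nil {m j : ℕ} {s : List (Fin j → ℤ)} (hs : s ∈ grid m j) : s ≠ [] := by
  cases j with
  | zero => simp only [grid, List.mem_singleton] at hs; simp [hs]
  | succ j =>
    obtain ⟨e, -, σ, -, t, ht, rfl⟩ := mem_grid hs
    simpa using ne_nil_of_mem_sh ht

lemma grid_count {m : ℕ} (hm : 0 < m) (j : ℕ) :
    pr (grid m j) (cut (fun x => outInd m x + 1) (cups (List.replicate j sgn) one)) = 1 := by
  induction j with
  | zero => simp [grid, pr, outInd, Outer]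
  | succ j ih =>
    rw [pr_grid, pr_comm]
    refine Eq.trans (pr_congr ?_) ih
    intro σ hσ
    simp only [cut_map, cups_map, List.map_replicate, one_map]
    obtain ⟨y, ys, rfl⟩ := List.exists_cons_of_ne_nil (grid_ne_nil hσ)
    have hc : ∀ (b : ℤ) (e : ZMod 2), b ≠ 0 → (if 0 < b then 0 else 1) = e →
        X (cut (fun p : ℤ × (Fin j → ℤ) => outInd m (Fin.cons p.1 p.2 : Fin (j + 1) → ℤ) + 1)
          (cups (List.replicate (j + 1)
            fun p : ℤ × (Fin j → ℤ) => sgn (Fin.cons p.1 p.2 : Fin (j + 1) → ℤ)) one))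
          [0, b] (y :: ys) = (outInd m y + 1) *
            ((e + sgn ((y :: ys).getLast (by simp))) * cups (List.replicate j sgn) one (y :: ys)) := by
      intro b e hb he
      rw [X_cut, outInd_cons hm, X_cups_edge (fun x => sgn x) e]
      · intro y; exact sgn_cons_zero y
      · intro y; rw [← he]; exact sgn_cons hb y
    rw [pr_edges_eq hm]
    · rw [hc 1 0 (by simp) (by simp), hc (-1) 1 (by simp) (by simp), cut_cons]
      linear_combination (outInd m y + 1) * cups (List.replicate j sgn) one (y :: ys) *
        two_zero (sgn ((y :: ys).getLast (by simp)))
    · intro k hk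
      have hz : ∀ (e : List ℤ) (b : ZMod 2), (∀ p ∈ e, p ≠ 0 ∧ (if 0 < p then 0 else 1) = b) →
          e ≠ [] → X (cut (fun p : ℤ × (Fin j → ℤ) =>
            outInd m (Fin.cons p.1 p.2 : Fin (j + 1) → ℤ) + 1) (cups (List.replicate (j + 1)
              fun p : ℤ × (Fin j → ℤ) => sgn (Fin.cons p.1 p.2 : Fin (j + 1) → ℤ)) one))
            e (y :: ys) = 0 := by
        intro e b he hne
        obtain ⟨p, e, rfl⟩ := List.exists_cons_of_ne_nil hne
        rw [X_cut, List.replicate_succ, cups_cons, X_cup_eq_zero b, mul_zero]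
        intro q hq x _
        rw [← (he q hq).2]
        exact sgn_cons (he q hq).1 x
      constructor
      · refine hz _ 0 (fun p hp => ?_) (edge_ne_nil k)
        unfold edge at hp
        split_ifs at hp <;> simp at hp <;> refine ⟨by omega, if_pos (by omega)⟩
      · refine hz _ 1 (fun p hp => ?_) (by simpa using edge_ne_nil k)
        unfold edge at hp
        split_ifs at hp <;> simp at hp <;> refine ⟨by omega, if_neg (by omega)⟩

end Grid

section Base

/-- The triangulated cubical sphere. -/
noncomputable def shell (m n : ℕ) : List (List (Fin (n + 1) → ℤ)) :=
  cap (outInd m) (grid m (n + 1))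

lemma outInd_eq_one {m j : ℕ} {x : Fin j → ℤ} (hx : Outer m x) : outInd m x = 1 := if_pos hx

lemma outInd_eq_zero {m j : ℕ} {x : Fin j → ℤ} (hx : ¬ Outer m x) : outInd m x = 0 := if_neg hx

lemma outInd_neg (m : ℕ) {j : ℕ} (x : Fin j → ℤ) : outInd m (-x) = outInd m x := by
  have h : Outer m (-x) ↔ Outer m x := by simp [Outer]
  by_cases hx : Outer m x
  · rw [outInd_eq_one hx, outInd_eq_one (h.2 hx)]
  · rw [outInd_eq_zero hx, outInd_eq_zero (hx ∘ h.1)]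

lemma shell_neg (m n : ℕ) (w : List (Fin (n + 1) → ℤ) → ZMod 2) :
    pr (shell m n) (fun l => w (l.map Neg.neg)) = pr (shell m n) w := by
  rw [shell, pr_cap, pr_cap, ← pr_grid_neg]
  congr 1
  funext l
  simp [cup_map, outInd_neg]

lemma shell_d (m n : ℕ) {w : List (Fin (n + 1) → ℤ) → ZMod 2} (hw : w [] = 0) :
    pr (shell m n) (d w) = 0 := by
  rw [shell, pr_cap, ← funext (d_cup (outInd m) hw)]
  refine pr_grid_d m _ rfl fun l hl => ?_
  rcases l with _ | ⟨a, _ | ⟨b, l⟩⟩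
  · rfl
  · rfl
  · rw [cup_cons, outInd_eq_one (hl a (by simp)), outInd_eq_one (hl b (by simp)), two_zero,
      zero_mul]

lemma shell_odd {m : ℕ} (hm : 0 < m) (n : ℕ) :
    pr (shell m n) (cut (fun x => sgn x + 1) (cups (List.replicate n sgn) one)) = 1 := by
  set u : List (Fin (n + 1) → ℤ) → ZMod 2 :=
    cut (fun x => sgn x + 1) (cups (List.replicate n sgn) one) with hu
  have h1 : d u = cups (List.replicate (n + 1) sgn) one := by
    funext l
    rw [hu, d_cut _ (cups_apply_nil _ one_nil), d_cups_one, cup_add_const, List.replicate_succ,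
      cups_cons]
    have : cut (fun x : Fin (n + 1) → ℤ => sgn x + 1) (fun _ => 0) l = 0 := by
      rcases l with _ | ⟨a, l⟩ <;> simp
    rw [this, add_zero]
  have h2 : pr (grid m (n + 1)) (d (cut (fun x => outInd m x + 1) u)) = 0 := by
    refine pr_grid_d m _ rfl fun l hl => ?_
    rcases l with _ | ⟨a, l⟩
    · rfl
    · rw [cut_cons, outInd_eq_one (hl a (by simp)), two_zero, zero_mul]
  rw [funext (d_cut _ (w := u) rfl), pr_add, h1, grid_count hm, cup_add_const] at h2
  rw [shell, pr_cap, CharTwo.add_eq_zero.1 h2]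

lemma shell_sorted {m n : ℕ} {s : List (Fin (n + 1) → ℤ)} (hs : s ∈ shell m n) :
    s.Pairwise fun x y => ∑ i, (x i).natAbs % 2 < ∑ i, (y i).natAbs % 2 := by
  obtain ⟨t, ht, h, -⟩ := mem_cap hs
  exact (grid_sorted ht).sublist h.sublist

lemma shell_close {m n : ℕ} {s : List (Fin (n + 1) → ℤ)} (hs : s ∈ shell m n)
    {x y : Fin (n + 1) → ℤ} (hx : x ∈ s) (hy : y ∈ s) (i : Fin (n + 1)) : |x i - y i| ≤ 1 := by
  obtain ⟨t, ht, h, -⟩ := mem_cap hs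
  exact grid_close ht (h.subset hx) (h.subset hy) i

lemma shell_large {m n : ℕ} {s : List (Fin (n + 1) → ℤ)} (hs : s ∈ shell m n)
    {x : Fin (n + 1) → ℤ} (hx : x ∈ s) : ∃ i, m ≤ (x i).natAbs + 1 := by
  obtain ⟨t, ht, h, p, hp, q, hq, hpq⟩ := mem_cap hs
  have : Outer m p ∨ Outer m q := by
    by_contra! hc
    exact hpq (by rw [outInd_eq_zero hc.1, outInd_eq_zero hc.2])
  have key : ∀ p ∈ t, Outer m p → ∃ i, m ≤ (x i).natAbs + 1 := by
    rintro p hp ⟨i, hi⟩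
    have := abs_le.1 (grid_close ht (h.subset hx) hp i)
    exact ⟨i, by omega⟩
  exact this.elim (key p hp) (key q hq)

/-- The direction of an integer point. -/
noncomputable def dir {n : ℕ} (x : Fin n → ℤ) : EuclideanSpace ℝ (Fin n) :=
  let v : EuclideanSpace ℝ (Fin n) := WithLp.toLp 2 fun i => (x i : ℝ)
  ‖v‖⁻¹ • v

lemma dir_neg {n : ℕ} (x : Fin n → ℤ) : dir (-x) = -dir x := by
  have : (WithLp.toLp 2 fun i => (((-x) i : ℤ) : ℝ) : EuclideanSpace ℝ (Fin n)) =
      -WithLp.toLp 2 fun i => (x i : ℝ) := by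
    ext i; simp
  simp only [dir, this, norm_neg, smul_neg]

lemma norm_dir_sub_le {E : Type*} [NormedAddCommGroup E] [NormedSpace ℝ E] {a b : E} (ha : a ≠ 0)
    (hb : b ≠ 0) : ‖‖a‖⁻¹ • a - ‖b‖⁻¹ • b‖ ≤ 2 * ‖a - b‖ / ‖a‖ := by
  have ha' := norm_pos_iff.2 ha
  have hb' := norm_pos_iff.2 hb
  have h1 : ‖a‖⁻¹ • a - ‖b‖⁻¹ • b = ‖a‖⁻¹ • (a - b) + (‖a‖⁻¹ - ‖b‖⁻¹) • b := by
    rw [smul_sub, sub_smul]; abel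
  have h2 : |‖a‖⁻¹ - ‖b‖⁻¹| * ‖b‖ = |‖b‖ - ‖a‖| / ‖a‖ := by
    rw [inv_sub_inv ha'.ne' hb'.ne', abs_div, abs_of_pos (mul_pos ha' hb')]
    field_simp
  have h3 : |‖b‖ - ‖a‖| ≤ ‖a - b‖ := by
    rw [abs_sub_comm]; exact abs_norm_sub_norm_le a b
  calc ‖‖a‖⁻¹ • a - ‖b‖⁻¹ • b‖ ≤ ‖‖a‖⁻¹ • (a - b)‖ + ‖(‖a‖⁻¹ - ‖b‖⁻¹) • b‖ := by
        rw [h1]; exact norm_add_le _ _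
    _ = ‖a - b‖ / ‖a‖ + |‖b‖ - ‖a‖| / ‖a‖ := by
        rw [norm_smul, norm_smul, Real.norm_eq_abs, Real.norm_eq_abs, h2, abs_of_pos (inv_pos.2 ha'),
          inv_mul_eq_div]
    _ ≤ ‖a - b‖ / ‖a‖ + ‖a - b‖ / ‖a‖ := by gcongr
    _ = 2 * ‖a - b‖ / ‖a‖ := by ring

lemma dist_dir_le {m n : ℕ} (hm : 1 < m) {s : List (Fin (n + 1) → ℤ)} (hs : s ∈ shell m n)
    {x y : Fin (n + 1) → ℤ} (hx : x ∈ s) (hy : y ∈ s) :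
    dist (dir x) (dir y) ≤ 2 * (n + 1) / ((m : ℝ) - 1) ∧ ‖dir x‖ = 1 := by
  set v : (Fin (n + 1) → ℤ) → EuclideanSpace ℝ (Fin (n + 1)) :=
    fun x => WithLp.toLp 2 fun i => (x i : ℝ) with hv
  have hm' : (0 : ℝ) < m - 1 := by
    have : (1 : ℝ) < m := by exact_mod_cast hm
    linarith
  have key : ∀ x ∈ s, (m : ℝ) - 1 ≤ ‖v x‖ := fun x hx => by
    obtain ⟨i, hi⟩ := shell_large hs hx
    have h1 := PiLp.norm_apply_le (v x) i
    have h2 : ‖v x i‖ = ((x i).natAbs : ℝ) := by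
      simp [hv, Nat.cast_natAbs]
    have h3 : (m : ℝ) ≤ ((x i).natAbs : ℝ) + 1 := by exact_mod_cast hi
    linarith
  have hne : ∀ x ∈ s, v x ≠ 0 := fun x hx => norm_pos_iff.1 (hm'.trans_le (key x hx))
  have hd : ‖v x - v y‖ ≤ n + 1 := by
    rw [EuclideanSpace.norm_eq]
    refine (Real.sqrt_le_left (by positivity)).2 ?_
    calc ∑ i, ‖(v x - v y) i‖ ^ 2 ≤ ∑ i : Fin (n + 1), (1 : ℝ) := by
          refine Finset.sum_le_sum fun i _ => ?_
          have h1 : ((|x i - y i| : ℤ) : ℝ) ≤ 1 := by exact_mod_cast shell_close hs hx hy i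
          have h2 : ‖(v x - v y) i‖ = ((|x i - y i| : ℤ) : ℝ) := by simp [hv]
          rw [h2]
          exact pow_le_one₀ (by positivity) h1
      _ = n + 1 := by simp
      _ ≤ (n + 1 : ℝ) ^ 2 := by nlinarith [(Nat.cast_nonneg n : (0 : ℝ) ≤ n)]
  constructor
  · rw [dist_eq_norm]
    refine (norm_dir_sub_le (hne x hx) (hne y hy)).trans ?_
    have := key x hx
    gcongr
  · change ‖‖v x‖⁻¹ • v x‖ = 1
    rw [norm_smul, norm_inv, norm_norm, inv_mul_cancel₀ (norm_ne_zero_iff.2 (hne x hx))]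

/-- Extension by zero from the unit sphere. -/
noncomputable def extZero {E : Type*} [NormedAddCommGroup E] {N : ℕ}
    (F : Metric.sphere (0 : E) 1 → Fin N → ℝ) : E → Fin N → ℝ :=
  Function.extend Subtype.val F 0

lemma extZero_neg {E : Type*} [NormedAddCommGroup E] {N : ℕ}
    {F : Metric.sphere (0 : E) 1 → Fin N → ℝ} (hF : ∀ x, F (-x) = F x) (v : E) :
    extZero F (-v) = extZero F v := by
  by_cases hv : v ∈ Metric.sphere (0 : E) 1
  · have h1 : extZero F v = F ⟨v, hv⟩ := Subtype.val_injective.extend_apply F 0 ⟨v, hv⟩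
    have h2 : extZero F (-v) = F (-(⟨v, hv⟩ : Metric.sphere (0 : E) 1)) :=
      Subtype.val_injective.extend_apply F 0 (-(⟨v, hv⟩ : Metric.sphere (0 : E) 1))
    rw [h1, h2, hF]
  · rw [extZero, Function.extend_apply', Function.extend_apply']
    · rfl
    · rintro ⟨a, rfl⟩; exact hv a.2
    · rintro ⟨a, ha⟩; exact hv (by have := a.2; rw [ha] at this; simpa using this)

/-- The sphere itself is a symmetric cycle of single points. -/
theorem hasSys_sphere {n N : ℕ}
    {F : Metric.sphere (0 : EuclideanSpace ℝ (Fin (n + 1))) 1 → Fin N → ℝ} (hF : Continuous F)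
    (hF' : ∀ x, F (-x) = F x) : HasSys F n 1 := by
  intro om hom
  refine ⟨1, one_pos, fun eta heta => ?_⟩
  obtain ⟨δ, hδ, hFδ⟩ := Metric.uniformContinuous_iff.1
    (CompactSpace.uniformContinuous_of_continuous hF) eta heta
  obtain ⟨m, hm⟩ := exists_nat_gt (2 * (n + 1) / min (δ / 2) eta + 1)
  have hmin : 0 < min (δ / 2) eta := by positivity
  have hm1 : (1 : ℝ) < m := lt_of_le_of_lt (by simp; positivity) hm
  have hm2 : 1 < m := by exact_mod_cast hm1
  have hm3 : 2 * (n + 1) / ((m : ℝ) - 1) ≤ min (δ / 2) eta := by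
    rw [div_le_iff₀ (by linarith), ← div_le_iff₀' hmin]
    linarith
  have hne : ∀ s ∈ shell m n, ∀ x ∈ s, x ≠ 0 := fun s hs x hx => by
    obtain ⟨i, hi⟩ := shell_large hs hx
    rintro rfl
    simp at hi
    omega
  have hsph : ∀ s ∈ shell m n, ∀ x ∈ s,
      dir x ∈ Metric.sphere (0 : EuclideanSpace ℝ (Fin (n + 1))) 1 := fun s hs x hx => by
    simpa using (dist_dir_le hm2 hs hx hx).2
  have hdir : ∀ s (hs : s ∈ shell m n) x (hx : x ∈ s),
      extZero F (dir x) = F ⟨dir x, hsph s hs x hx⟩ := fun s hs x hx =>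
    Subtype.val_injective.extend_apply F 0 ⟨dir x, hsph s hs x hx⟩
  let lift : (Fin (n + 1) → ℤ) → (Fin (n + 1) → ℤ) × ZMod 2 := fun x => (x, sgn x)
  have hmem : ∀ {σ}, σ ∈ (shell m n).map (List.map lift) → ∃ s ∈ shell m n, s.map lift = σ :=
    fun h => List.mem_map.1 h
  refine ⟨(Fin (n + 1) → ℤ) × ZMod 2, fun z => (-z.1, z.2 + 1), fun z => z.2,
    fun z => ∑ i, (z.1 i).natAbs % 2, fun z => dir z.1, fun z => extZero F (dir z.1),
    (shell m n).map (List.map lift), ?_⟩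
  constructor
  · rintro ⟨x, s⟩
    simp only [neg_neg, add_assoc, two_zero, add_zero]
  · exact fun _ => rfl
  · simp
  · exact fun z => dir_neg z.1
  · intro z
    rw [dir_neg, extZero_neg hF']
  · intro σ hσ
    obtain ⟨s, hs, rfl⟩ := hmem hσ
    rw [List.pairwise_map]
    exact shell_sorted hs
  · intro σ hσ a ha b hb
    obtain ⟨s, hs, rfl⟩ := hmem hσ
    obtain ⟨x, hx, rfl⟩ := List.mem_map.1 ha
    obtain ⟨y, hy, rfl⟩ := List.mem_map.1 hb
    exact (dist_dir_le hm2 hs hx hy).1.trans (hm3.trans (min_le_right _ _))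
  · intro σ hσ a ha b hb
    obtain ⟨s, hs, rfl⟩ := hmem hσ
    obtain ⟨x, hx, rfl⟩ := List.mem_map.1 ha
    obtain ⟨y, hy, rfl⟩ := List.mem_map.1 hb
    have h1 := (dist_dir_le hm2 hs hx hy).1.trans (hm3.trans (min_le_left _ _))
    simp only [lift, hdir s hs x hx, hdir s hs y hy]
    refine (hFδ ?_).le
    rw [Subtype.dist_eq]
    exact h1.trans_lt (by linarith)
  · intro w
    rw [pr_map, pr_map, ← shell_neg]
    refine pr_congr fun s hs => ?_
    simp only [List.map_map]
    congr 1
    refine List.map_congr_left fun x hx => ?_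
    simp only [Function.comp, lift, neg_neg]
    rw [sgn_neg (hne s hs x hx), add_assoc, two_zero, add_zero]
  · intro w hw
    rw [pr_map]
    simp only [← d_comp_map]
    exact shell_d m n hw
  · rw [pr_map]
    simp only [cut_map, cups_map, one_map, List.map_replicate]
    exact shell_odd (by omega) n
  · intro σ hσ a ha
    obtain ⟨s, hs, rfl⟩ := hmem hσ
    obtain ⟨x, hx, rfl⟩ := List.mem_map.1 ha
    refine ⟨fun _ => ⟨dir x, hsph s hs x hx⟩, fun _ => ?_, fun _ => ?_,
      fun i j hij => absurd (Subsingleton.elim i j) hij⟩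
    · simpa [lift] using hom.le
    · simpa [lift, hdir s hs x hx] using heta.le

end Base

section Limit

variable {E : Type*} [NormedAddCommGroup E] {N K D : ℕ} {F : Metric.sphere (0 : E) 1 → Fin N → ℝ}

lemma Sys.exists_tuple {om rho eta : ℝ} {Z : Type} {T : Z → Z} {lam : Z → ZMod 2} {rk : Z → ℕ}
    {pos : Z → E} {h : Z → Fin N → ℝ} {c : List (List Z)}
    (S : Sys F D K om rho eta T lam rk pos h c) :
    ∃ x : Fin K → Metric.sphere (0 : E) 1, (∀ i j, dist (x i) (x j) ≤ 2 * om) ∧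
      (∀ i j, dist (F (x i)) (F (x j)) ≤ 2 * eta) ∧ ∀ i j, i ≠ j → rho ≤ dist (x i) (x j) := by
  have hne : ∃ σ ∈ c, σ ≠ [] := by
    by_contra! hc
    have h1 := S.odd
    rw [pr, List.map_congr_left (g := fun _ => 0) fun σ hσ => by rw [hc σ hσ]; rfl] at h1
    simp at h1
  obtain ⟨σ, hσ, hne⟩ := hne
  obtain ⟨a, ha⟩ := List.exists_mem_of_ne_nil σ hne
  obtain ⟨x, h1, h2, h3⟩ := S.leaf σ hσ a ha
  refine ⟨x, fun i j => ?_, fun i j => ?_, h3⟩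
  · rw [Subtype.dist_eq]
    linarith [dist_triangle_right (x i : E) (x j) (pos a), h1 i, h1 j]
  · linarith [dist_triangle_right (F (x i)) (F (x j)) (h a), h2 i, h2 j]

lemma HasSys.exists_tuple [ProperSpace E] (hF : Continuous F) (hS : HasSys F D K) {om : ℝ}
    (hom : 0 < om) :
    ∃ x : Fin K → Metric.sphere (0 : E) 1, (∀ i j, dist (x i) (x j) ≤ 2 * om) ∧
      (∀ i j, F (x i) = F (x j)) ∧ Function.Injective x := by
  obtain ⟨rho, hrho, hS⟩ := hS om hom
  have (m : ℕ) : ∃ x : Fin K → Metric.sphere (0 : E) 1, (∀ i j, dist (x i) (x j) ≤ 2 * om) ∧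
      (∀ i j, dist (F (x i)) (F (x j)) ≤ 2 * (1 / ((m : ℝ) + 1))) ∧
      ∀ i j, i ≠ j → rho ≤ dist (x i) (x j) := by
    obtain ⟨Z, T, lam, rk, pos, h, c, S⟩ := hS _ (Nat.one_div_pos_of_nat (n := m))
    exact S.exists_tuple
  choose x h1 h2 h3 using this
  obtain ⟨y, φ, hφ, hy⟩ := CompactSpace.tendsto_subseq x
  have hyi (i : Fin K) := tendsto_pi_nhds.1 hy i
  have hd (i j : Fin K) := (hyi i).dist (hyi j)
  refine ⟨y, fun i j => le_of_tendsto' (hd i j) fun m => h1 _ i j, fun i j => ?_, fun i j hij => ?_⟩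
  · have hl := (((hF.tendsto _).comp (hyi i)).dist ((hF.tendsto _).comp (hyi j)))
    have hz := ((tendsto_one_div_add_atTop_nhds_zero_nat (𝕜 := ℝ)).comp hφ.tendsto_atTop).const_mul 2
    rw [mul_zero] at hz
    exact dist_le_zero.1 (le_of_tendsto_of_tendsto' hl hz fun m => h2 _ i j)
  · by_contra hne
    have := ge_of_tendsto' (hd i j) fun m => h3 _ i j hne
    rw [hij, dist_self] at this
    exact hrho.not_ge this

/-- Points of the sphere with close preimages of equal values accumulate somewhere. -/
lemma HasSys.exists_point [ProperSpace E] (hF : Continuous F) (hS : HasSys F D K) (hK : 0 < K) :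
    ∃ y : Metric.sphere (0 : E) 1, ∀ r > 0, ∃ x : Fin K → Metric.sphere (0 : E) 1,
      (∀ i, dist (x i) y < r) ∧ (∀ i j, F (x i) = F (x j)) ∧ Function.Injective x := by
  choose x h1 h2 h3 using fun m : ℕ => hS.exists_tuple hF (Nat.one_div_pos_of_nat (n := m))
  obtain ⟨y, φ, hφ, hy⟩ := CompactSpace.tendsto_subseq fun m => x m ⟨0, hK⟩
  refine ⟨y, fun r hr => ?_⟩
  have hz := ((tendsto_one_div_add_atTop_nhds_zero_nat (𝕜 := ℝ)).comp hφ.tendsto_atTop).const_mul 2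
  have hs := (tendsto_iff_dist_tendsto_zero.1 hy).add hz
  rw [mul_zero, add_zero] at hs
  obtain ⟨m, hm⟩ := (hs.eventually_lt_const hr).exists
  refine ⟨x (φ m), fun i => ?_, h2 _, h3 _⟩
  calc dist (x (φ m) i) y ≤ dist (x (φ m) ⟨0, hK⟩) y + dist (x (φ m) i) (x (φ m) ⟨0, hK⟩) := by
        linarith [dist_triangle (x (φ m) i) (x (φ m) ⟨0, hK⟩) y]
    _ ≤ _ := add_le_add le_rfl (h1 (φ m) i ⟨0, hK⟩)
    _ < r := hm

end Limit

lemma HasSys.iterate {E : Type*} [NormedAddCommGroup E] [NormedSpace ℝ E] {N b l n : ℕ}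
    {F : Metric.sphere (0 : E) 1 → Fin N → ℝ} (hS : HasSys F n 1) (hn : n + b = N + 1)
    (hl : N + 1 = 2 ^ l - 1) : ∀ m, 2 ^ m * b ≤ N + 1 → HasSys F (N + 1 - 2 ^ m * b) (2 ^ m)
  | 0, _ => by
    have : N + 1 - 2 ^ 0 * b = n := by omega
    rwa [this, pow_zero]
  | m + 1, h => by
    rw [pow_succ', mul_assoc] at h ⊢
    exact (HasSys.iterate hS hn hl m (by omega)).double (by positivity) (by omega) (by omega) hl

section Projective

variable {E : Type*} [NormedAddCommGroup E] [NormedSpace ℝ E]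

/-- The projection of the unit sphere onto projective space. -/
noncomputable def toProj (x : Metric.sphere (0 : E) 1) : Projectivization ℝ E :=
  Projectivization.mk ℝ (x : E) (ne_zero_of_mem_unit_sphere x)

lemma continuous_toProj : Continuous (toProj (E := E)) := by
  have : Continuous fun x : Metric.sphere (0 : E) 1 =>
      (⟨x, ne_zero_of_mem_unit_sphere x⟩ : {v : E // v ≠ 0}) :=
    continuous_subtype_val.subtype_mk _
  exact (continuous_quotient_mk' (s := projectivizationSetoid ℝ E)).comp this

lemma toProj_neg (x : Metric.sphere (0 : E) 1) : toProj (-x) = toProj x :=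
  (Projectivization.mk_eq_mk_iff' ℝ _ _ _ _).2 ⟨-1, by simp⟩

lemma eq_of_toProj_eq {x y : Metric.sphere (0 : E) 1} (h : toProj x = toProj y)
    (hd : dist x y < 2) : x = y := by
  obtain ⟨t, ht⟩ := (Projectivization.mk_eq_mk_iff' ℝ _ _ _ _).1 h
  have hx : ‖(x : E)‖ = 1 := norm_eq_of_mem_sphere x
  have hy : ‖(y : E)‖ = 1 := norm_eq_of_mem_sphere y
  have : |t| = 1 := by
    rw [← ht, norm_smul, hy, mul_one] at hx
    exact hx
  rcases eq_or_eq_neg_of_abs_eq this with rfl | rfl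
  · exact Subtype.ext (by rw [← ht, one_smul])
  · rw [Subtype.dist_eq, ← ht, dist_eq_norm] at hd
    have : (-1 : ℝ) • (y : E) - y = (-2 : ℝ) • (y : E) := by module
    rw [this, norm_smul, hy] at hd
    norm_num at hd

end Projective

end ProjMult

/-- Every continuous map `ℝP^{2^ℓ-2-a} → ℝ^{2^ℓ-2}` admits a local `k`-multiplicity,
whenever `k ≥ 2` is a power of `2` and `k(a+1) ≤ 2^ℓ - 1`. -/
theorem localMultiplicity_of_continuous_projective_to_euclidean
    (a ℓ k : ℕ) (ha : 1 ≤ a) (hℓ : 1 ≤ ℓ) (hk : 2 ≤ k) (hk2 : ∃ i : ℕ, k = 2 ^ i)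
    (hka : k * (a + 1) ≤ 2 ^ ℓ - 1)
    (f : Projectivization ℝ (EuclideanSpace ℝ (Fin (2 ^ ℓ - 2 - a + 1))) →
      EuclideanSpace ℝ (Fin (2 ^ ℓ - 2)))
    (hf : Continuous f) :
    AdmitsLocalMultiplicity f k := by
  obtain ⟨m, rfl⟩ := hk2
  have hb : 2 * (a + 1) ≤ 2 ^ ℓ - 1 := (Nat.mul_le_mul_right _ hk).trans hka
  set F : Metric.sphere (0 : EuclideanSpace ℝ (Fin (2 ^ ℓ - 2 - a + 1))) 1 →
    Fin (2 ^ ℓ - 2) → ℝ := fun x => WithLp.ofLp (f (ProjMult.toProj x)) with hF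
  have hFc : Continuous F := (PiLp.continuous_ofLp 2 _).comp (hf.comp ProjMult.continuous_toProj)
  have hFn (x) : F (-x) = F x := by simp only [hF, ProjMult.toProj_neg]
  have hS := ((ProjMult.hasSys_sphere hFc hFn).iterate (b := a + 1) (l := ℓ) (by omega)
    (by omega)) m (by omega)
  obtain ⟨y, hy⟩ := hS.exists_point hFc (by positivity)
  refine ⟨ProjMult.toProj y, fun U hU => ?_⟩
  obtain ⟨r, hr, hrU⟩ := Metric.mem_nhds_iff.1 (ProjMult.continuous_toProj.continuousAt hU)
  obtain ⟨x, hx1, hx2, hx3⟩ := hy (min r 1) (lt_min hr one_pos)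
  refine ⟨fun i => ProjMult.toProj (x i), fun i j hij => hx3 (ProjMult.eq_of_toProj_eq hij ?_),
    fun i => hrU ((hx1 i).trans_le (min_le_left _ _)), fun i j => WithLp.ofLp_injective 2 (hx2 i j)⟩
  linarith [dist_triangle_right (x i) (x j) y, (hx1 i).trans_le (min_le_right _ _),
    (hx1 j).trans_le (min_le_right _ _)]
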